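/- Assume m + p = 2 (so that the assumption on σ reads σ > 2). Then there exists σ0 > 2 such that for every σ ∈ (2, σ0), the profile equation (SSODE) admits good profiles with interface having each of the three possible behaviors (B1), (B2) and (B3) at the origin (i.e. for each of (B1), (B2), (B3) there exists a good profile with interface with that behavior). -/

import Mathlib

open Real Filter Set Topology

noncomputable def alphaC (m p σ : ℝ) : ℝ := (σ + 2) / (σ * (m - 1) + 2 * (p - 1))

noncomputable def betaC (m p σ : ℝ) : ℝ := (m - p) / (σ * (m - 1) + 2 * (p - 1))

/-- The self-similar profile ODE (SSODE) at the point `ξ`. -/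
def SSODE (N : ℕ) (m p σ : ℝ) (f : ℝ → ℝ) (ξ : ℝ) : Prop :=
  deriv (deriv fun x => f x ^ m) ξ + ((N : ℝ) - 1) / ξ * deriv (fun x => f x ^ m) ξ
    - alphaC m p σ * f ξ + betaC m p σ * ξ * deriv f ξ + ξ ^ σ * f ξ ^ p = 0

/-- `f` is a profile with interface at `ξ0`. -/
def ProfileWithInterface (N : ℕ) (m p σ : ℝ) (f : ℝ → ℝ) (ξ0 : ℝ) : Prop :=
  0 < ξ0 ∧
  ContinuousOn f (Icc 0 ξ0) ∧
  (∀ ξ ∈ Ioo 0 ξ0, 0 < f ξ) ∧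
  ContDiffOn ℝ 2 f (Ioo 0 ξ0) ∧
  (∀ ξ ∈ Ioo 0 ξ0, SSODE N m p σ f ξ) ∧
  f ξ0 = 0 ∧
  Tendsto (fun ξ => deriv (fun x => f x ^ m) ξ) (𝓝[<] ξ0) (𝓝 0)

/-- Interface of Type I: `f(ξ) ~ (ξ0 - ξ)^(1/(m-1))` as `ξ → ξ0⁻`. -/
def TypeI (m : ℝ) (f : ℝ → ℝ) (ξ0 : ℝ) : Prop :=
  ∃ c, 0 < c ∧ Tendsto (fun ξ => f ξ * (ξ0 - ξ) ^ (-(1 / (m - 1)))) (𝓝[<] ξ0) (𝓝 c)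

/-- Interface of Type II: `f(ξ) ~ (ξ0 - ξ)^(1/(1-p))` as `ξ → ξ0⁻`. -/
def TypeII (p : ℝ) (f : ℝ → ℝ) (ξ0 : ℝ) : Prop :=
  ∃ c, 0 < c ∧ Tendsto (fun ξ => f ξ * (ξ0 - ξ) ^ (-(1 / (1 - p)))) (𝓝[<] ξ0) (𝓝 c)

/-- Behavior (B1) at the origin. -/
def BehB1 (N : ℕ) (m p σ : ℝ) (f : ℝ → ℝ) : Prop :=
  0 < f 0 ∧ Tendsto (fun ξ => (f ξ ^ (m - 1) - f 0 ^ (m - 1)) / ξ ^ 2)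
    (𝓝[>] 0) (𝓝 (alphaC m p σ * (m - 1) / (2 * m * (N : ℝ))))

/-- Behavior (B2) at the origin. -/
def BehB2 (N : ℕ) (m : ℝ) (f : ℝ → ℝ) : Prop :=
  f 0 = 0 ∧ Tendsto (fun ξ => f ξ * ξ ^ (-(2 / (m - 1)))) (𝓝[>] 0)
    (𝓝 (((m - 1) / (2 * m * (m * (N : ℝ) - (N : ℝ) + 2))) ^ (1 / (m - 1))))

/-- Behavior (B3) at the origin. -/
def BehB3 (m p σ : ℝ) (f : ℝ → ℝ) : Prop :=
  f 0 = 0 ∧ ∃ K, 0 < K ∧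
    Tendsto (fun ξ => f ξ * ξ ^ (-((σ + 2) / (m - p)))) (𝓝[>] 0) (𝓝 K)

/-- A good profile with interface at `ξ0`. -/
def GoodProfile (N : ℕ) (m p σ : ℝ) (f : ℝ → ℝ) (ξ0 : ℝ) : Prop :=
  ProfileWithInterface N m p σ f ξ0 ∧
  (BehB1 N m p σ f ∨ BehB2 N m f ∨ BehB3 m p σ f)

noncomputable def xiMax (m p σ : ℝ) : ℝ := (betaC m p σ ^ 2 / (4 * m)) ^ (1 / (σ - 2))
/-! Part 1: truncated field, existence, invariance -/

noncomputable def Zf (e t : ℝ) : ℝ := e ^ 2 * exp (e * t)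

noncomputable def YP (m n e t U P : ℝ) : ℝ :=
  -((1 / (m - 1)) * P ^ 2 + (2 / m) * P + (m - 1) / m * Zf e t) / U - n * P + (4 + e) / m

noncomputable def cl (l u x : ℝ) : ℝ := max l (min u x)

lemma cl_mem {l u : ℝ} (h : l ≤ u) (x : ℝ) : cl l u x ∈ Icc l u := by
  unfold cl
  exact ⟨le_max_left _ _, max_le h (min_le_left _ _)⟩

lemma cl_eq {l u x : ℝ} (h : x ∈ Icc l u) : cl l u x = x := by
  unfold cl
  rw [min_eq_right h.2, max_eq_right h.1]

lemma cl_lip (l u : ℝ) : LipschitzWith 1 (cl l u) := by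
  unfold cl
  exact (LipschitzWith.id.const_min u).const_max l

noncomputable def Fc (m n e ta tb l u B : ℝ) (t : ℝ) (y : ℝ × ℝ) : ℝ × ℝ :=
  (cl (-B) B y.2 - 2 * cl l u y.1, YP m n e (cl ta tb t) (cl l u y.1) (cl (-B) B y.2))

noncomputable def Hc (m n e : ℝ) (w : ℝ × ℝ × ℝ) : ℝ × ℝ :=
  (w.2.2 - 2 * w.2.1, YP m n e w.1 w.2.1 w.2.2)

lemma Hc_contDiffOn (m n e ta tb l u B : ℝ) (hl : 0 < l) :
    ContDiffOn ℝ 1 (Hc m n e) (Icc ta tb ×ˢ Icc l u ×ˢ Icc (-B) B) := by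
  unfold Hc YP Zf
  have : ∀ w ∈ (Icc ta tb ×ˢ Icc l u ×ˢ Icc (-B) B : Set (ℝ × ℝ × ℝ)), w.2.1 ≠ 0 := by
    rintro ⟨a, b, c⟩ ⟨_, h, _⟩
    exact (lt_of_lt_of_le hl h.1).ne'
  refine ContDiffOn.prodMk (by fun_prop) ?_
  refine ContDiffOn.add (ContDiffOn.sub (ContDiffOn.div (by fun_prop) (by fun_prop) this)
    (by fun_prop)) (by fun_prop)

lemma Fc_eq (m n e ta tb l u B : ℝ) (w : ℝ × ℝ × ℝ) :
    Fc m n e ta tb l u B w.1 w.2 =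
      Hc m n e (cl ta tb w.1, cl l u w.2.1, cl (-B) B w.2.2) := rfl

lemma Fc_lip (m n e ta tb l u B : ℝ) (ht : ta ≤ tb) (hl : 0 < l) (hlu : l ≤ u) (hB : 0 ≤ B) :
    ∃ K, LipschitzWith K (fun w : ℝ × ℝ × ℝ => Fc m n e ta tb l u B w.1 w.2) := by
  obtain ⟨K, hK⟩ := (Hc_contDiffOn m n e ta tb l u B hl).exists_lipschitzOnWith (by norm_num)
    ((convex_Icc _ _).prod ((convex_Icc _ _).prod (convex_Icc _ _)))
    (isCompact_Icc.prod (isCompact_Icc.prod isCompact_Icc))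
  have h1 : LipschitzWith (max (1 * 1) (max (1 * (1 * 1)) (1 * (1 * 1))))
      (fun w : ℝ × ℝ × ℝ => (cl ta tb w.1, cl l u w.2.1, cl (-B) B w.2.2)) :=
    ((cl_lip ta tb).comp LipschitzWith.prod_fst).prodMk
      (((cl_lip l u).comp (LipschitzWith.prod_fst.comp LipschitzWith.prod_snd)).prodMk
      ((cl_lip (-B) B).comp (LipschitzWith.prod_snd.comp LipschitzWith.prod_snd)))
  have h2 := hK.comp (f := fun w : ℝ × ℝ × ℝ => (cl ta tb w.1, cl l u w.2.1, cl (-B) B w.2.2))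
    (s := univ) h1.lipschitzOnWith
    (fun w _ => ⟨cl_mem ht _, cl_mem hlu _, cl_mem (by linarith) _⟩)
  exact ⟨_, lipschitzOnWith_univ.1 h2⟩

lemma Fc_bdd (m n e ta tb l u B : ℝ) (ht : ta ≤ tb) (hl : 0 < l) (hlu : l ≤ u) (hB : 0 ≤ B) :
    ∃ C : NNReal, ∀ t y, ‖Fc m n e ta tb l u B t y‖ ≤ C := by
  obtain ⟨C, hC⟩ := (isCompact_Icc.prod (isCompact_Icc.prod isCompact_Icc)).exists_bound_of_continuousOn
    (Hc_contDiffOn m n e ta tb l u B hl).continuousOn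
  refine ⟨⟨max C 0, le_max_right _ _⟩, fun t y => ?_⟩
  refine le_trans ?_ (le_max_left _ _)
  exact hC (cl ta tb t, cl l u y.1, cl (-B) B y.2) ⟨cl_mem ht _, cl_mem hlu _, cl_mem (by linarith) _⟩

lemma Fc_exists (m n e ta tb l u B : ℝ) (ht : ta ≤ tb) (hl : 0 < l) (hlu : l ≤ u) (hB : 0 ≤ B)
    (t0 : ℝ) (h0 : t0 ∈ Icc ta tb) (y0 : ℝ × ℝ) :
    ∃ y : ℝ → ℝ × ℝ, y t0 = y0 ∧ ∀ t ∈ Icc ta tb, HasDerivAt y (Fc m n e ta tb l u B t (y t)) t := by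
  obtain ⟨K, hK⟩ := Fc_lip m n e ta tb l u B ht hl hlu hB
  obtain ⟨C, hC⟩ := Fc_bdd m n e ta tb l u B ht hl hlu hB
  have hmem : t0 ∈ Icc (ta - 1) (tb + 1) := ⟨by linarith [h0.1], by linarith [h0.2]⟩
  have hpl : IsPicardLindelof (Fc m n e ta tb l u B) (⟨t0, hmem⟩ : Icc (ta - 1) (tb + 1)) y0
      (C * ⟨tb - ta + 2, by linarith⟩) 0 C K := by
    refine ⟨?_, ?_, ?_, ?_⟩
    · intro t _
      apply LipschitzWith.lipschitzOnWith
      have := hK.comp (LipschitzWith.prodMk_left t)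
      rw [mul_one] at this
      exact this
    · intro x _
      have : Continuous fun t => Fc m n e ta tb l u B t x :=
        hK.continuous.comp (by fun_prop : Continuous fun t : ℝ => (t, x))
      exact this.continuousOn
    · intro t _ x _
      exact hC t x
    · simp only [NNReal.coe_mul, NNReal.coe_zero, sub_zero]
      apply mul_le_mul_of_nonneg_left _ C.2
      apply max_le <;> simp only <;> linarith [h0.1, h0.2]
  obtain ⟨y, hy0, hy⟩ := hpl.exists_eq_forall_mem_Icc_hasDerivWithinAt₀
  refine ⟨y, hy0, fun t ht => ?_⟩
  exact (hy t ⟨by linarith [ht.1], by linarith [ht.2]⟩).hasDerivAt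
    (Icc_mem_nhds (by linarith [ht.1]) (by linarith [ht.2]))

/-- forward invariance with strict inward derivative at contact -/
lemma invar {ι : Type*} [Finite ι] {a b : ℝ} (h h' : ι → ℝ → ℝ)
    (hd : ∀ i, ∀ t ∈ Icc a b, HasDerivAt (h i) (h' i t) t) (h0 : ∀ i, 0 ≤ h i a)
    (hs : ∀ t ∈ Ico a b, (∀ j, 0 ≤ h j t) → ∀ i, h i t = 0 → 0 < h' i t) :
    ∀ t ∈ Icc a b, ∀ i, 0 ≤ h i t := by
  have hcl : IsClosed ({t | ∀ i, 0 ≤ h i t} ∩ Icc a b) := by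
    have : ({t | ∀ i, 0 ≤ h i t} ∩ Icc a b) = Icc a b ∩ ⋂ i, (Icc a b ∩ (h i) ⁻¹' (Ici 0)) := by
      ext t
      simp only [mem_inter_iff, mem_ofPred_eq, mem_iInter, mem_preimage, mem_Ici]
      exact ⟨fun ⟨a, b⟩ => ⟨b, fun i => ⟨b, a i⟩⟩, fun ⟨a, b⟩ => ⟨fun i => (b i).2, a⟩⟩
    rw [this]
    refine isClosed_Icc.inter (isClosed_iInter fun i => ?_)
    exact ContinuousOn.preimage_isClosed_of_isClosed
      (fun t ht => (hd i t ht).continuousAt.continuousWithinAt) isClosed_Icc isClosed_Ici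
  refine hcl.Icc_subset_of_forall_mem_nhdsWithin h0 ?_
  rintro x ⟨hx, hxab⟩
  have : ∀ i, ∀ᶠ t in 𝓝[>] x, 0 ≤ h i t := by
    intro i
    have hdi := hd i x (Ico_subset_Icc_self hxab)
    rcases (hx i).eq_or_lt with h1 | h1
    · have hp := hs x hxab hx i h1.symm
      have h2 := (hasDerivAt_iff_tendsto_slope.1 hdi).eventually (lt_mem_nhds hp)
      have h3 : 𝓝[>] x ≤ 𝓝[≠] x := nhdsWithin_mono _ (fun y hy => ne_of_gt hy)
      filter_upwards [h3 h2, self_mem_nhdsWithin] with t ht htx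
      rw [slope_def_field, ← h1, sub_zero] at ht
      have : 0 < t - x := sub_pos.2 htx
      exact ((div_pos_iff_of_pos_right this).1 ht).le
    · have := hdi.continuousAt.eventually (lt_mem_nhds h1)
      exact (this.filter_mono nhdsWithin_le_nhds).mono fun t ht => ht.le
  exact eventually_all.2 this

lemma gronwall_back {K : NNReal} {v : ℝ → ℝ × ℝ → ℝ × ℝ} (hv : ∀ t, LipschitzWith K (v t))
    {f g : ℝ → ℝ × ℝ} {a b : ℝ} (hf : ∀ t ∈ Icc a b, HasDerivAt f (v t (f t)) t)
    (hg : ∀ t ∈ Icc a b, HasDerivAt g (v t (g t)) t) :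
    ∀ t ∈ Icc a b, dist (f t) (g t) ≤ dist (f b) (g b) * exp (K * (b - t)) := by
  have key : ∀ f : ℝ → ℝ × ℝ, (∀ t ∈ Icc a b, HasDerivAt f (v t (f t)) t) →
      ∀ s ∈ Icc (-b) (-a), HasDerivAt (fun s => f (-s)) (-(v (-s) (f (-s)))) s := by
    intro f hf s hs
    have h1 := hf (-s) ⟨by linarith [hs.2], by linarith [hs.1]⟩
    have := HasDerivAt.scomp s h1 (hasDerivAt_neg s)
    rw [neg_one_smul] at this
    exact this
  have h := dist_le_of_trajectories_ODE (v := fun s y => -(v (-s) y)) (K := K)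
    (f := fun s => f (-s)) (g := fun s => g (-s)) (a := -b) (b := -a) (δ := dist (f b) (g b))
    (fun t => (hv (-t)).neg) (fun t ht => (key f hf t ht).continuousAt.continuousWithinAt)
    (fun t ht => (key f hf t (Ico_subset_Icc_self ht)).hasDerivWithinAt)
    (fun t ht => (key g hg t ht).continuousAt.continuousWithinAt)
    (fun t ht => (key g hg t (Ico_subset_Icc_self ht)).hasDerivWithinAt) (by simp)
  intro t ht
  have := h (-t) ⟨by linarith [ht.2], by linarith [ht.1]⟩
  simpa [sub_eq_add_neg, add_comm] using this

def IsSol (m n e : ℝ) (U P : ℝ → ℝ) (t : ℝ) : Prop :=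
  0 < U t ∧ HasDerivAt U (P t - 2 * U t) t ∧ HasDerivAt P (YP m n e t (U t) (P t)) t

def Box (l1 u1 l2 u2 : ℝ → ℝ) (θ t U P : ℝ) : Prop :=
  l1 t ≤ U ∧ U ≤ u1 t ∧ l2 t ≤ P - θ * U ∧ P - θ * U ≤ u2 t

lemma hasDerivAt_fst {y : ℝ → ℝ × ℝ} {y' : ℝ × ℝ} {t : ℝ} (h : HasDerivAt y y' t) :
    HasDerivAt (fun t => (y t).1) y'.1 t :=
  (ContinuousLinearMap.fst ℝ ℝ ℝ).hasFDerivAt.comp_hasDerivAt t h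

lemma hasDerivAt_snd {y : ℝ → ℝ × ℝ} {y' : ℝ × ℝ} {t : ℝ} (h : HasDerivAt y y' t) :
    HasDerivAt (fun t => (y t).2) y'.2 t :=
  (ContinuousLinearMap.snd ℝ ℝ ℝ).hasFDerivAt.comp_hasDerivAt t h

lemma box_consts (l1 u1 l2 u2 : ℝ → ℝ) (θ ta t1 : ℝ) (hta : ta ≤ t1)
    (c1 : Continuous l1) (c2 : Continuous u1) (c3 : Continuous l2) (c4 : Continuous u2)
    (hpos : ∀ t ≤ t1, 0 < l1 t) :
    ∃ l u B, 0 < l ∧ l ≤ u ∧ 0 ≤ B ∧ ∀ t ∈ Icc ta t1, ∀ U P, Box l1 u1 l2 u2 θ t U P →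
      U ∈ Icc l u ∧ P ∈ Icc (-B) B := by
  obtain ⟨x, hx, hmin⟩ := isCompact_Icc.exists_isMinOn (nonempty_Icc.2 hta) c1.continuousOn
  obtain ⟨C1, hC1⟩ := isCompact_Icc.exists_bound_of_continuousOn (s := Icc ta t1) c2.continuousOn
  obtain ⟨C2, hC2⟩ := isCompact_Icc.exists_bound_of_continuousOn (s := Icc ta t1) c3.continuousOn
  obtain ⟨C3, hC3⟩ := isCompact_Icc.exists_bound_of_continuousOn (s := Icc ta t1) c4.continuousOn
  have hC10 := (norm_nonneg _).trans (hC1 x hx)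
  have hC20 := (norm_nonneg _).trans (hC2 x hx)
  have hC30 := (norm_nonneg _).trans (hC3 x hx)
  refine ⟨l1 x, max (l1 x) C1, C2 + C3 + |θ| * C1, hpos x hx.2, le_max_left _ _, by positivity, ?_⟩
  rintro t ht U P ⟨h1, h2, h3, h4⟩
  have a1 := abs_le.1 (hC1 t ht)
  have a2 := abs_le.1 (hC2 t ht)
  have a3 := abs_le.1 (hC3 t ht)
  have hm : l1 x ≤ l1 t := hmin ht
  have hU : |U| ≤ C1 := abs_le.2 ⟨by linarith [hpos x hx.2], by linarith⟩
  have hθ : |θ * U| ≤ |θ| * C1 := by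
    rw [abs_mul]; exact mul_le_mul_of_nonneg_left hU (abs_nonneg _)
  have := abs_le.1 hθ
  exact ⟨⟨by linarith, le_max_of_le_right (by linarith)⟩, ⟨by linarith, by linarith⟩⟩

lemma back_k {m n e θ t1 : ℝ} {l1 u1 l2 u2 l1' u1' l2' u2' : ℝ → ℝ}
  (d1 : ∀ t, HasDerivAt l1 (l1' t) t) (d2 : ∀ t, HasDerivAt u1 (u1' t) t)
  (d3 : ∀ t, HasDerivAt l2 (l2' t) t) (d4 : ∀ t, HasDerivAt u2 (u2' t) t)
  (hpos : ∀ t ≤ t1, 0 < l1 t) (hle1 : ∀ t ≤ t1, l1 t ≤ u1 t) (hle2 : ∀ t ≤ t1, l2 t ≤ u2 t)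
  (e1 : ∀ t ≤ t1, ∀ U P, Box l1 u1 l2 u2 θ t U P → U = l1 t → l1' t < P - 2 * U)
  (e2 : ∀ t ≤ t1, ∀ U P, Box l1 u1 l2 u2 θ t U P → U = u1 t → P - 2 * U < u1' t)
  (e3 : ∀ t ≤ t1, ∀ U P, Box l1 u1 l2 u2 θ t U P → P - θ * U = l2 t →
    l2' t < YP m n e t U P - θ * (P - 2 * U))
  (e4 : ∀ t ≤ t1, ∀ U P, Box l1 u1 l2 u2 θ t U P → P - θ * U = u2 t →
    YP m n e t U P - θ * (P - 2 * U) < u2' t)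
    (ta : ℝ) (hta : ta ≤ t1) {l u B : ℝ} (hl : 0 < l) (hlu : l ≤ u) (hB : 0 ≤ B)
    (hb : ∀ t ∈ Icc ta t1, ∀ U P, Box l1 u1 l2 u2 θ t U P → U ∈ Icc l u ∧ P ∈ Icc (-B) B) :
    ∃ y : ℝ → ℝ × ℝ, ∀ t ∈ Icc ta t1, Box l1 u1 l2 u2 θ t (y t).1 (y t).2 ∧
      HasDerivAt y ((y t).2 - 2 * (y t).1, YP m n e t (y t).1 (y t).2) t := by
  obtain ⟨y, hy0, hy⟩ := Fc_exists m n e ta t1 l u B hta hl hlu hB ta ⟨le_rfl, hta⟩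
    (l1 ta, l2 ta + θ * l1 ta)
  have hF : ∀ t ∈ Icc ta t1, Box l1 u1 l2 u2 θ t (y t).1 (y t).2 →
      Fc m n e ta t1 l u B t (y t) = ((y t).2 - 2 * (y t).1, YP m n e t (y t).1 (y t).2) := by
    intro t ht hbx
    obtain ⟨h1, h2⟩ := hb t ht _ _ hbx
    unfold Fc
    rw [cl_eq h1, cl_eq h2, cl_eq ht]
  have hbox : ∀ t ∈ Icc ta t1, Box l1 u1 l2 u2 θ t (y t).1 (y t).2 := by
    have key := invar (ι := Fin 4) (a := ta) (b := t1)
      ![fun t => (y t).1 - l1 t, fun t => u1 t - (y t).1,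
        fun t => ((y t).2 - θ * (y t).1) - l2 t, fun t => u2 t - ((y t).2 - θ * (y t).1)]
      ![fun t => (Fc m n e ta t1 l u B t (y t)).1 - l1' t,
        fun t => u1' t - (Fc m n e ta t1 l u B t (y t)).1,
        fun t => ((Fc m n e ta t1 l u B t (y t)).2 - θ * (Fc m n e ta t1 l u B t (y t)).1) - l2' t,
        fun t => u2' t - ((Fc m n e ta t1 l u B t (y t)).2
          - θ * (Fc m n e ta t1 l u B t (y t)).1)] ?_ ?_ ?_
    · intro t ht
      have := key t ht
      have k0 : 0 ≤ (y t).1 - l1 t := this 0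
      have k1 : 0 ≤ u1 t - (y t).1 := this 1
      have k2 : 0 ≤ ((y t).2 - θ * (y t).1) - l2 t := this 2
      have k3 : 0 ≤ u2 t - ((y t).2 - θ * (y t).1) := this 3
      exact ⟨by linarith, by linarith, by linarith, by linarith⟩
    · intro i t ht
      have f1 := hasDerivAt_fst (hy t ht)
      have f2 := hasDerivAt_snd (hy t ht)
      fin_cases i
      · exact f1.sub (d1 t)
      · exact (d2 t).sub f1
      · exact (f2.sub (f1.const_mul θ)).sub (d3 t)
      · exact (d4 t).sub (f2.sub (f1.const_mul θ))
    · intro i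
      have a1 := hle1 ta hta
      have a2 := hle2 ta hta
      fin_cases i
      · change 0 ≤ (y ta).1 - l1 ta
        rw [hy0]; simp
      · change 0 ≤ u1 ta - (y ta).1
        rw [hy0]; simpa using a1
      · change 0 ≤ ((y ta).2 - θ * (y ta).1) - l2 ta
        rw [hy0]; simp
      · change 0 ≤ u2 ta - ((y ta).2 - θ * (y ta).1)
        rw [hy0]; simpa using a2
    · intro t ht hall i
      have ht' := Ico_subset_Icc_self ht
      have k0 : 0 ≤ (y t).1 - l1 t := hall 0
      have k1 : 0 ≤ u1 t - (y t).1 := hall 1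
      have k2 : 0 ≤ ((y t).2 - θ * (y t).1) - l2 t := hall 2
      have k3 : 0 ≤ u2 t - ((y t).2 - θ * (y t).1) := hall 3
      have hbx : Box l1 u1 l2 u2 θ t (y t).1 (y t).2 :=
        ⟨by linarith, by linarith, by linarith, by linarith⟩
      have hFt := hF t ht' hbx
      fin_cases i
      · change (y t).1 - l1 t = 0 → 0 < (Fc m n e ta t1 l u B t (y t)).1 - l1' t
        intro h; rw [hFt]
        have := e1 t ht'.2 _ _ hbx (by linarith)
        simp only; linarith
      · change u1 t - (y t).1 = 0 → 0 < u1' t - (Fc m n e ta t1 l u B t (y t)).1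
        intro h; rw [hFt]
        have := e2 t ht'.2 _ _ hbx (by linarith)
        simp only; linarith
      · change ((y t).2 - θ * (y t).1) - l2 t = 0 → 0 < ((Fc m n e ta t1 l u B t (y t)).2 -
          θ * (Fc m n e ta t1 l u B t (y t)).1) - l2' t
        intro h; rw [hFt]
        have := e3 t ht'.2 _ _ hbx (by linarith)
        simp only; linarith
      · change u2 t - ((y t).2 - θ * (y t).1) = 0 → 0 < u2' t - ((Fc m n e ta t1 l u B t (y t)).2 -
          θ * (Fc m n e ta t1 l u B t (y t)).1)
        intro h; rw [hFt]
        have := e4 t ht'.2 _ _ hbx (by linarith)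
        simp only; linarith
  refine ⟨y, fun t ht => ⟨hbox t ht, ?_⟩⟩
  rw [← hF t ht (hbox t ht)]
  exact hy t ht

theorem back_exists {m n e θ t1 : ℝ} {l1 u1 l2 u2 l1' u1' l2' u2' : ℝ → ℝ}
  (d1 : ∀ t, HasDerivAt l1 (l1' t) t) (d2 : ∀ t, HasDerivAt u1 (u1' t) t)
  (d3 : ∀ t, HasDerivAt l2 (l2' t) t) (d4 : ∀ t, HasDerivAt u2 (u2' t) t)
  (hpos : ∀ t ≤ t1, 0 < l1 t) (hle1 : ∀ t ≤ t1, l1 t ≤ u1 t) (hle2 : ∀ t ≤ t1, l2 t ≤ u2 t)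
  (e1 : ∀ t ≤ t1, ∀ U P, Box l1 u1 l2 u2 θ t U P → U = l1 t → l1' t < P - 2 * U)
  (e2 : ∀ t ≤ t1, ∀ U P, Box l1 u1 l2 u2 θ t U P → U = u1 t → P - 2 * U < u1' t)
  (e3 : ∀ t ≤ t1, ∀ U P, Box l1 u1 l2 u2 θ t U P → P - θ * U = l2 t →
    l2' t < YP m n e t U P - θ * (P - 2 * U))
  (e4 : ∀ t ≤ t1, ∀ U P, Box l1 u1 l2 u2 θ t U P → P - θ * U = u2 t →
    YP m n e t U P - θ * (P - 2 * U) < u2' t)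
    : ∃ U P : ℝ → ℝ, ∀ t ≤ t1, Box l1 u1 l2 u2 θ t (U t) (P t) ∧
    IsSol m n e U P t := by
  have cc1 : Continuous l1 := continuous_iff_continuousAt.2 fun t => (d1 t).continuousAt
  have cc2 : Continuous u1 := continuous_iff_continuousAt.2 fun t => (d2 t).continuousAt
  have cc3 : Continuous l2 := continuous_iff_continuousAt.2 fun t => (d3 t).continuousAt
  have cc4 : Continuous u2 := continuous_iff_continuousAt.2 fun t => (d4 t).continuousAt
  have hk0 : ∀ k : ℕ, t1 - k ≤ t1 := fun k => by
    have : (0 : ℝ) ≤ k := Nat.cast_nonneg k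
    linarith
  have hcst := fun k : ℕ => box_consts l1 u1 l2 u2 θ (t1 - k) t1 (hk0 k) cc1 cc2 cc3 cc4 hpos
  choose l u B hl hlu hB hb using hcst
  have hsol := fun k : ℕ => back_k d1 d2 d3 d4 hpos hle1 hle2 e1 e2 e3 e4 (t1 - k) (hk0 k)
    (hl k) (hlu k) (hB k) (hb k)
  choose y hy using hsol
  -- convergent subsequence at t1
  have hmem : ∀ k, y k t1 ∈ Icc (l 0) (u 0) ×ˢ Icc (-(B 0)) (B 0) := by
    intro k
    have h1 := (hy k t1 ⟨hk0 k, le_rfl⟩).1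
    exact hb 0 t1 ⟨by simp, le_rfl⟩ _ _ h1
  obtain ⟨yb, hyb, φ, hφ, hlim⟩ := (isCompact_Icc.prod isCompact_Icc).tendsto_subseq hmem
  have hex := fun k : ℕ => Fc_exists m n e (t1 - k) t1 (l k) (u k) (B k) (hk0 k) (hl k) (hlu k)
    (hB k) t1 ⟨hk0 k, le_rfl⟩ yb
  choose x hx0 hx using hex
  have hFy : ∀ k j : ℕ, k ≤ j → ∀ t ∈ Icc (t1 - k) t1,
      HasDerivAt (y j) (Fc m n e (t1 - k) t1 (l k) (u k) (B k) t (y j t)) t := by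
    intro k j hkj t ht
    have hkj' : (k : ℝ) ≤ j := Nat.cast_le.2 hkj
    have h1 := hy j t ⟨by linarith [ht.1], ht.2⟩
    obtain ⟨h2, h3⟩ := hb k t ht _ _ h1.1
    have : Fc m n e (t1 - k) t1 (l k) (u k) (B k) t (y j t)
        = ((y j t).2 - 2 * (y j t).1, YP m n e t (y j t).1 (y j t).2) := by
      unfold Fc
      rw [cl_eq h2, cl_eq h3, cl_eq ht]
    rw [this]; exact h1.2
  have hconv : ∀ k : ℕ, ∀ t ∈ Icc (t1 - k) t1, Tendsto (fun j => y (φ j) t) atTop (𝓝 (x k t)) := by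
    intro k t ht
    obtain ⟨K, hK⟩ := Fc_lip m n e (t1 - k) t1 (l k) (u k) (B k) (hk0 k) (hl k) (hlu k) (hB k)
    have hKt : ∀ t, LipschitzWith K (Fc m n e (t1 - k) t1 (l k) (u k) (B k) t) := by
      intro t
      have := hK.comp (LipschitzWith.prodMk_left t)
      rw [mul_one] at this
      exact this
    rw [tendsto_iff_dist_tendsto_zero]
    have hz : Tendsto (fun j => dist (y (φ j) t1) yb * exp (K * (t1 - t))) atTop (𝓝 0) := by
      have := (tendsto_iff_dist_tendsto_zero.1 hlim).mul_const (exp (K * (t1 - t)))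
      simpa using this
    refine squeeze_zero' (Eventually.of_forall fun _ => dist_nonneg) ?_ hz
    filter_upwards [eventually_ge_atTop k] with j hj
    have h := gronwall_back hKt (hFy k (φ j) (hj.trans (hφ.id_le j))) (hx k) t ht
    rwa [hx0] at h
  have hbx : ∀ k : ℕ, ∀ t ∈ Icc (t1 - k) t1, Box l1 u1 l2 u2 θ t (x k t).1 (x k t).2 := by
    intro k t ht
    have h := hconv k t ht
    have h1 : Tendsto (fun j => (y (φ j) t).1) atTop (𝓝 (x k t).1) :=
      (continuous_fst.tendsto _).comp h
    have h2 : Tendsto (fun j => (y (φ j) t).2) atTop (𝓝 (x k t).2) :=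
      (continuous_snd.tendsto _).comp h
    have hev : ∀ᶠ j in atTop, Box l1 u1 l2 u2 θ t (y (φ j) t).1 (y (φ j) t).2 := by
      filter_upwards [eventually_ge_atTop k] with j hj
      have : (k : ℝ) ≤ φ j := Nat.cast_le.2 (hj.trans (hφ.id_le j))
      exact (hy (φ j) t ⟨by linarith [ht.1], ht.2⟩).1
    have h3 := h2.sub (h1.const_mul θ)
    exact ⟨ge_of_tendsto h1 (hev.mono fun j h => h.1), le_of_tendsto h1 (hev.mono fun j h => h.2.1),
      ge_of_tendsto h3 (hev.mono fun j h => h.2.2.1), le_of_tendsto h3 (hev.mono fun j h => h.2.2.2)⟩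
  have hagree : ∀ k j : ℕ, ∀ t, t ∈ Icc (t1 - k) t1 → t ∈ Icc (t1 - j) t1 → x k t = x j t :=
    fun k j t h1 h2 => tendsto_nhds_unique (hconv k t h1) (hconv j t h2)
  have hxs : ∀ k : ℕ, ∀ t ∈ Icc (t1 - k) t1,
      HasDerivAt (x k) ((x k t).2 - 2 * (x k t).1, YP m n e t (x k t).1 (x k t).2) t := by
    intro k t ht
    obtain ⟨h2, h3⟩ := hb k t ht _ _ (hbx k t ht)
    have : Fc m n e (t1 - k) t1 (l k) (u k) (B k) t (x k t)
        = ((x k t).2 - 2 * (x k t).1, YP m n e t (x k t).1 (x k t).2) := by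
      unfold Fc
      rw [cl_eq h2, cl_eq h3, cl_eq ht]
    rw [← this]; exact hx k t ht
  -- global solution
  let w : ℝ → ℝ × ℝ := fun t => if t1 < t then x 1 t else x (⌈t1 - t⌉₊) t
  have hw1 : ∀ t > t1, w t = x 1 t := fun t ht => if_pos ht
  have hw2 : ∀ k : ℕ, ∀ t ∈ Icc (t1 - k) t1, w t = x k t := by
    intro k t ht
    have : w t = x (⌈t1 - t⌉₊) t := if_neg (not_lt.2 ht.2)
    rw [this]
    apply hagree _ _ _ _ ht
    have := Nat.le_ceil (t1 - t)
    exact ⟨by linarith, ht.2⟩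
  have hloc : ∀ t ≤ t1, ∃ k : ℕ, t ∈ Icc (t1 - k) t1 ∧ w =ᶠ[𝓝 t] x k := by
    intro t ht
    rcases ht.eq_or_lt with h | h
    · refine ⟨1, ⟨by simp [h], ht⟩, ?_⟩
      have : Ioi (t1 - 1) ∈ 𝓝 t := Ioi_mem_nhds (by linarith)
      filter_upwards [this] with s hs
      rcases lt_or_ge t1 s with h1 | h1
      · exact hw1 s h1
      · exact hw2 1 s ⟨by have := mem_Ioi.1 hs; push_cast; linarith, h1⟩
    · obtain ⟨k, hk⟩ := exists_nat_gt (t1 - t)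
      refine ⟨k, ⟨by linarith, ht⟩, ?_⟩
      have : Ioo (t1 - k) t1 ∈ 𝓝 t := Ioo_mem_nhds (by linarith) h
      filter_upwards [this] with s hs
      exact hw2 k s (Ioo_subset_Icc_self hs)
  refine ⟨fun t => (w t).1, fun t => (w t).2, fun t ht => ?_⟩
  obtain ⟨k, hk, hwk⟩ := hloc t ht
  have hB1 : Box l1 u1 l2 u2 θ t (w t).1 (w t).2 := by
    rw [hwk.self_of_nhds]; exact hbx k t hk
  have hd : HasDerivAt w ((w t).2 - 2 * (w t).1, YP m n e t (w t).1 (w t).2) t := by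
    rw [hwk.self_of_nhds]; exact (hxs k t hk).congr_of_eventuallyEq hwk
  exact ⟨hB1, lt_of_lt_of_le (hpos t ht) hB1.1, hasDerivAt_fst hd, hasDerivAt_snd hd⟩

lemma Zf_pos {e : ℝ} (he : 0 < e) (t : ℝ) : 0 < Zf e t := by unfold Zf; positivity

lemma Zf_mono {e : ℝ} (he : 0 < e) {s t : ℝ} (h : s ≤ t) : Zf e s ≤ Zf e t := by
  unfold Zf; gcongr

lemma Zf_deriv (e t : ℝ) : HasDerivAt (Zf e) (e * Zf e t) t := by
  unfold Zf
  have := (((hasDerivAt_id t).const_mul e).exp).const_mul (e ^ 2)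
  refine this.congr_deriv ?_
  simp only [id]; ring

lemma edge_low {m n e t x P : ℝ} (hm : 1 < m) (hn : 1 ≤ n) (he : 0 < e) (hx : 0 < x)
    (hZ : Zf e t ≤ 1 / m) (hP : P = -((m - 1) * Zf e t)) :
    0 < YP m n e t x P + (m - 1) * (e * Zf e t) := by
  have hz := Zf_pos he t
  have hμ : 0 < m - 1 := by linarith
  unfold YP
  have h1 : -((1 / (m - 1)) * P ^ 2 + (2 / m) * P + (m - 1) / m * Zf e t)
      = (m - 1) * Zf e t * (1 / m - Zf e t) := by
    rw [hP]; field_simp; ring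
  rw [h1]
  have h2 : 0 ≤ (m - 1) * Zf e t * (1 / m - Zf e t) / x := by
    have : 0 ≤ 1 / m - Zf e t := by linarith
    positivity
  have h3 : 0 ≤ -(n * P) := by rw [hP]; ring_nf; nlinarith [mul_pos hμ hz, mul_pos (mul_pos hμ hz) (by linarith : 0 < n)]
  have h4 : 0 < (4 + e) / m := by positivity
  have h5 : 0 < (m - 1) * (e * Zf e t) := by positivity
  linarith

lemma edge_up {m n e t x : ℝ} (hm : 1 < m) (hn : 1 ≤ n) (he : 0 < e) (he1 : e < 1) (hx : 0 < x) :
    YP m n e t x (5 / m) < 0 := by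
  have hz := Zf_pos he t
  have hμ : 0 < m - 1 := by linarith
  unfold YP
  have h2 : 0 < ((1 / (m - 1)) * (5 / m) ^ 2 + (2 / m) * (5 / m) + (m - 1) / m * Zf e t) / x := by
    positivity
  have h3 : 5 / m ≤ n * (5 / m) := le_mul_of_one_le_left (by positivity) hn
  have h4 : (4 + e) / m < 5 / m := by gcongr; linarith
  rw [neg_div]
  linarith

noncomputable def Phi (m n U P : ℝ) : ℝ := U * (2 / m + P + (n / 2 + 2 * (1 / (m - 1)) - 1) * U)

lemma Phi_deriv {m n e t : ℝ} (hm : 1 < m) {U P : ℝ → ℝ} (h : IsSol m n e U P t) :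
    HasDerivAt (fun t => Phi m n (U t) (P t))
      (-((1 / (m - 1) - 1) * (P t - 2 * U t) ^ 2) - (2 * n + 4 * (1 / (m - 1))) * (U t) ^ 2
        + e / m * U t - (m - 1) / m * Zf e t) t := by
  obtain ⟨h0, h1, h2⟩ := h
  unfold Phi
  have h3 := h1.mul ((h2.const_add (2 / m)).add (h1.const_mul (n / 2 + 2 * (1 / (m - 1)) - 1)))
  refine h3.congr_deriv ?_
  have hY : U t * YP m n e t (U t) (P t) = -((1 / (m - 1)) * (P t) ^ 2 + (2 / m) * P t
      + (m - 1) / m * Zf e t) - n * U t * P t + (4 + e) / m * U t := by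
    unfold YP; field_simp
  change (P t - 2 * U t) * ((2 / m + P t) + (n / 2 + 2 * (1 / (m - 1)) - 1) * U t) +
      U t * (YP m n e t (U t) (P t) + (n / 2 + 2 * (1 / (m - 1)) - 1) * (P t - 2 * U t)) = _
  linear_combination hY

noncomputable def PhiMax (m n : ℝ) : ℝ :=
  (1 + 5 / m) * (2 / m + 5 / m + (n / 2 + 2 * (1 / (m - 1))) * (1 + 5 / m))

lemma phi_exit {m n e ta t2 : ℝ} (hm : 1 < m) (hm2 : m < 2) (hn : 1 ≤ n) (he : 0 < e) (he1 : e < 1)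
    (hta : Zf e ta = 1 / (2 * m)) (ht2 : Zf e t2 = 1 / m) (hlt : ta < t2)
    (hbig : PhiMax m n < (t2 - ta) * ((m - 1) / m / (4 * m)))
    {U P : ℝ → ℝ} (hs : ∀ t ∈ Icc ta t2, IsSol m n e U P t)
    (hP1 : P ta ≤ 5 / m) (hP2 : -((m - 1) * Zf e t2) ≤ P t2) (hU : U ta ≤ 1 + 5 / m) : False := by
  have hμ : 0 < m - 1 := by linarith
  set q := 1 / (m - 1) with hq
  have hq1 : 1 < q := by rw [hq, lt_div_iff₀ hμ]; linarith
  have hqμ : q * (m - 1) = 1 := by rw [hq]; field_simp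
  have hanti : AntitoneOn (fun t => Phi m n (U t) (P t) + (m - 1) / m / (4 * m) * t) (Icc ta t2) := by
    have hd : ∀ t ∈ Icc ta t2, HasDerivAt (fun t => Phi m n (U t) (P t) + (m - 1) / m / (4 * m) * t)
      (-((1 / (m - 1) - 1) * (P t - 2 * U t) ^ 2) - (2 * n + 4 * (1 / (m - 1))) * (U t) ^ 2
        + e / m * U t - (m - 1) / m * Zf e t + (m - 1) / m / (4 * m) * 1) t := fun t ht =>
      (Phi_deriv hm (hs t ht)).add ((hasDerivAt_id t).const_mul _)
    apply antitoneOn_of_deriv_nonpos (convex_Icc _ _)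
    · exact fun t ht => (hd t ht).continuousAt.continuousWithinAt
    · exact fun t ht => (hd t (interior_subset ht)).differentiableAt.differentiableWithinAt
    · intro t ht
      have ht' := interior_subset ht
      rw [(hd t ht').deriv, ← hq]
      have hz : 1 / (2 * m) ≤ Zf e t := hta ▸ Zf_mono he ht'.1
      have h1 : 0 ≤ (q - 1) * (P t - 2 * U t) ^ 2 := mul_nonneg (by linarith) (sq_nonneg _)
      have h2 : (m - 1) / m * (1 / (2 * m)) ≤ (m - 1) / m * Zf e t := by gcongr
      have h3 : e / m * U t ≤ (2 * n + 4 * q) * (U t) ^ 2 + (m - 1) / m / (4 * m) := by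
        have hU0 := (hs t ht').1
        have h4 : e / m * U t ≤ U t / m := by
          rw [div_mul_eq_mul_div]; gcongr; nlinarith
        have h5 : U t / m ≤ 4 * q * (U t) ^ 2 + (m - 1) / m / (4 * m) := by
          have : 4 * q * (U t) ^ 2 + (m - 1) / m / (4 * m) - U t / m
              = q * ((2 * U t - (m - 1) / (4 * m)) ^ 2 + 3 * ((m - 1) / (4 * m)) ^ 2) := by
            rw [hq]; field_simp; ring
          have h6 : 0 ≤ q * ((2 * U t - (m - 1) / (4 * m)) ^ 2 + 3 * ((m - 1) / (4 * m)) ^ 2) := by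
            positivity
          linarith
        have h7 : 0 ≤ 2 * n * (U t) ^ 2 := by positivity
        nlinarith
      have h8 : (m - 1) / m * (1 / (2 * m)) = 2 * ((m - 1) / m / (4 * m)) := by field_simp; ring
      linarith
  have hle := hanti (left_mem_Icc.2 hlt.le) (right_mem_Icc.2 hlt.le) hlt.le
  simp only at hle
  have hU1 := (hs ta (left_mem_Icc.2 hlt.le)).1
  have hU2 := (hs t2 (right_mem_Icc.2 hlt.le)).1
  have hpos : 0 < Phi m n (U t2) (P t2) := by
    unfold Phi
    apply mul_pos hU2
    rw [ht2] at hP2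
    have h1 : 0 < 2 / m - (m - 1) * (1 / m) := by
      have : 2 / m - (m - 1) * (1 / m) = (3 - m) / m := by field_simp; ring
      rw [this]; apply div_pos <;> linarith
    have h2 : 0 ≤ (n / 2 + 2 * (1 / (m - 1)) - 1) * U t2 := by
      rw [← hq]; apply mul_nonneg _ hU2.le; linarith
    linarith
  have hmax : Phi m n (U ta) (P ta) ≤ PhiMax m n := by
    unfold Phi PhiMax
    rw [← hq]
    have h0 : 0 < 2 / m + 5 / m := by positivity
    have h1 : (n / 2 + 2 * q - 1) * U ta ≤ (n / 2 + 2 * q) * (1 + 5 / m) := by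
      apply mul_le_mul _ hU hU1.le <;> linarith
    have h2 : 0 ≤ (n / 2 + 2 * q) * (1 + 5 / m) := by positivity
    calc U ta * (2 / m + P ta + (n / 2 + 2 * q - 1) * U ta)
        ≤ U ta * (2 / m + 5 / m + (n / 2 + 2 * q) * (1 + 5 / m)) := by gcongr
      _ ≤ _ := by gcongr
  linarith

lemma fwd_k {m n e ta t2 t1 U1 P1 δ : ℝ} (hm : 1 < m) (hm2 : m < 2) (hn : 1 ≤ n) (he : 0 < e)
    (he1 : e < 1) (h1a : t1 ≤ ta)
    (hta : Zf e ta = 1 / (2 * m)) (ht2 : Zf e t2 = 1 / m) (hlt : ta < t2)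
    (hbig : PhiMax m n < (t2 - ta) * ((m - 1) / m / (4 * m)))
    (hU1' : U1 ≤ exp (2 * (ta - t1)) + 5 / m)
    (hP1 : -((m - 1) * Zf e t1) ≤ P1) (hP1' : P1 ≤ 5 / m)
    (hδ : 0 < δ) (hδ1 : δ < U1) (hδ2 : δ < 5 / m) :
    ∃ (y : ℝ → ℝ × ℝ) (τ : ℝ), t1 < τ ∧ τ ≤ t2 ∧ y t1 = (U1, P1) ∧
      (∀ t ∈ Icc t1 t2, HasDerivAt y
        (Fc m n e t1 t2 δ (exp (2 * (ta - t1)) + 5 / m) (5 / m) t (y t)) t) ∧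
      (∀ t ∈ Icc t1 t2, (y t).1 ≤ exp (2 * (ta - t1)) + 5 / m ∧ (y t).2 ∈ Icc (-(5 / m)) (5 / m)) ∧
      (∀ t ∈ Ico t1 τ, δ < (y t).1) ∧ (y τ).1 ≤ δ := by
  have hμ : 0 < m - 1 := by linarith
  set u := exp (2 * (ta - t1)) + 5 / m with hu
  have h5 : 0 < 5 / m := by positivity
  have hB : (0 : ℝ) ≤ 5 / m := h5.le
  have hδu : δ ≤ u := by have := exp_pos (2 * (ta - t1)); linarith
  have h12 : t1 ≤ t2 := h1a.trans hlt.le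
  obtain ⟨y, hy0, hy⟩ := Fc_exists m n e t1 t2 δ u (5 / m) h12 hδ hδu hB t1 ⟨le_rfl, h12⟩ (U1, P1)
  have hZ : ∀ t ∈ Icc t1 t2, (m - 1) * Zf e t ≤ 5 / m := by
    intro t ht
    have : Zf e t ≤ 1 / m := ht2 ▸ Zf_mono he ht.2
    have h0 := Zf_pos he t
    calc (m - 1) * Zf e t ≤ 1 * (1 / m) := by
          apply mul_le_mul (by linarith) this h0.le (by norm_num)
      _ ≤ 5 / m := by rw [one_mul]; gcongr; norm_num
  have key := invar (ι := Fin 3) (a := t1) (b := t2)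
      ![fun t => (y t).2 + (m - 1) * Zf e t, fun t => 5 / m - (y t).2,
        fun t => (exp (2 * (ta - t)) + 5 / m) - (y t).1]
      ![fun t => (Fc m n e t1 t2 δ u (5 / m) t (y t)).2 + (m - 1) * (e * Zf e t),
        fun t => 0 - (Fc m n e t1 t2 δ u (5 / m) t (y t)).2,
        fun t => exp (2 * (ta - t)) * (2 * (0 - 1)) - (Fc m n e t1 t2 δ u (5 / m) t (y t)).1] ?_ ?_ ?_
  rotate_left
  · intro i t ht
    have f1 := hasDerivAt_fst (hy t ht)
    have f2 := hasDerivAt_snd (hy t ht)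
    fin_cases i
    · exact f2.add ((Zf_deriv e t).const_mul _)
    · exact (hasDerivAt_const t _).sub f2
    · exact (((((hasDerivAt_const t ta).sub (hasDerivAt_id t)).const_mul 2).exp).add_const _).sub f1
  · intro i
    fin_cases i
    · change 0 ≤ (y t1).2 + (m - 1) * Zf e t1
      rw [hy0]; simp only; linarith
    · change 0 ≤ 5 / m - (y t1).2
      rw [hy0]; simp only; linarith
    · change 0 ≤ (exp (2 * (ta - t1)) + 5 / m) - (y t1).1
      rw [hy0]; simp only; linarith
  · intro t ht hall i
    have ht' := Ico_subset_Icc_self ht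
    have k0 : 0 ≤ (y t).2 + (m - 1) * Zf e t := hall 0
    have k1 : 0 ≤ 5 / m - (y t).2 := hall 1
    have k2 : 0 ≤ (exp (2 * (ta - t)) + 5 / m) - (y t).1 := hall 2
    have hZt := hZ t ht'
    have hz1 : Zf e t ≤ 1 / m := ht2 ▸ Zf_mono he ht'.2
    have hPm : (y t).2 ∈ Icc (-(5 / m)) (5 / m) := ⟨by linarith, by linarith⟩
    have hx : 0 < cl δ u (y t).1 := lt_of_lt_of_le hδ (cl_mem hδu _).1
    fin_cases i
    · change (y t).2 + (m - 1) * Zf e t = 0 →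
        0 < (Fc m n e t1 t2 δ u (5 / m) t (y t)).2 + (m - 1) * (e * Zf e t)
      intro h
      unfold Fc
      rw [cl_eq ht', cl_eq hPm]
      exact edge_low hm hn he hx hz1 (by linarith)
    · change 5 / m - (y t).2 = 0 → 0 < 0 - (Fc m n e t1 t2 δ u (5 / m) t (y t)).2
      intro h
      unfold Fc
      rw [cl_eq ht', cl_eq hPm]
      have : (y t).2 = 5 / m := by linarith
      have := edge_up (t := t) hm hn he he1 hx
      simp only
      rw [show (y t).2 = 5 / m by linarith]
      linarith
    · change (exp (2 * (ta - t)) + 5 / m) - (y t).1 = 0 →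
        0 < exp (2 * (ta - t)) * (2 * (0 - 1)) - (Fc m n e t1 t2 δ u (5 / m) t (y t)).1
      intro h
      have hee := exp_pos (2 * (ta - t))
      have he2 : exp (2 * (ta - t)) ≤ exp (2 * (ta - t1)) := exp_le_exp.2 (by linarith [ht.1])
      have hUm : (y t).1 ∈ Icc δ u := ⟨by linarith, by linarith⟩
      unfold Fc
      rw [cl_eq hUm, cl_eq hPm]
      simp only
      linarith
  have hbd : ∀ t ∈ Icc t1 t2, 0 ≤ (y t).2 + (m - 1) * Zf e t ∧ 0 ≤ 5 / m - (y t).2 ∧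
      0 ≤ (exp (2 * (ta - t)) + 5 / m) - (y t).1 := fun t ht => ⟨key t ht 0, key t ht 1, key t ht 2⟩
  have hbd2 : ∀ t ∈ Icc t1 t2, (y t).1 ≤ u ∧ (y t).2 ∈ Icc (-(5 / m)) (5 / m) := by
    intro t ht
    obtain ⟨k0, k1, k2⟩ := hbd t ht
    have hZt := hZ t ht
    have he2 : exp (2 * (ta - t)) ≤ exp (2 * (ta - t1)) := exp_le_exp.2 (by linarith [ht.1])
    exact ⟨by linarith, by linarith, by linarith⟩
  have hyc : ContinuousOn (fun t => (y t).1) (Icc t1 t2) := fun t ht =>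
    (hasDerivAt_fst (hy t ht)).continuousAt.continuousWithinAt
  have hclosed : IsClosed (Icc t1 t2 ∩ (fun t => (y t).1) ⁻¹' (Iic δ)) :=
    hyc.preimage_isClosed_of_isClosed isClosed_Icc isClosed_Iic
  have hcomp : IsCompact (Icc t1 t2 ∩ (fun t => (y t).1) ⁻¹' (Iic δ)) :=
    isCompact_Icc.of_isClosed_subset hclosed inter_subset_left
  have hne : (Icc t1 t2 ∩ (fun t => (y t).1) ⁻¹' (Iic δ)).Nonempty := by
    by_contra hcon
    have hall : ∀ t ∈ Icc t1 t2, δ < (y t).1 := by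
      intro t ht
      by_contra h
      exact hcon ⟨t, ht, not_lt.1 h⟩
    have ha1 : ta ∈ Icc t1 t2 := ⟨h1a, hlt.le⟩
    have ha2 : t2 ∈ Icc t1 t2 := ⟨h12, le_rfl⟩
    refine phi_exit (U := fun t => (y t).1) (P := fun t => (y t).2) hm hm2 hn he he1 hta ht2 hlt hbig
      ?_ (hbd2 ta ha1).2.2 ?_ ?_
    · intro t ht
      have ht' : t ∈ Icc t1 t2 := ⟨h1a.trans ht.1, ht.2⟩
      have hd := hy t ht'
      obtain ⟨b1, b2⟩ := hbd2 t ht'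
      unfold Fc at hd
      rw [cl_eq ht', cl_eq b2, cl_eq ⟨(hall t ht').le, b1⟩] at hd
      exact ⟨hδ.trans (hall t ht'), hasDerivAt_fst hd, hasDerivAt_snd hd⟩
    · have := (hbd t2 ha2).1
      linarith
    · have := (hbd ta ha1).2.2
      simp only [sub_self, mul_zero, exp_zero] at this
      linarith
  obtain ⟨τ, ⟨hτ1, hτ2⟩, hτ3⟩ := hcomp.exists_isLeast hne
  refine ⟨y, τ, ?_, hτ1.2, hy0, hy, hbd2, ?_, hτ2⟩
  · refine lt_of_le_of_ne hτ1.1 ?_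
    rintro rfl
    have : (y t1).1 ≤ δ := hτ2
    rw [hy0] at this
    simp only at this
    linarith
  · intro t ht
    by_contra h
    have := hτ3 ⟨⟨ht.1, ht.2.le.trans hτ1.2⟩, not_lt.1 h⟩
    linarith [ht.2]

theorem fwd {m n e ta t2 t1 U1 P1 : ℝ} (hm : 1 < m) (hm2 : m < 2) (hn : 1 ≤ n) (he : 0 < e)
    (he1 : e < 1) (h1a : t1 ≤ ta)
    (hta : Zf e ta = 1 / (2 * m)) (ht2 : Zf e t2 = 1 / m) (hlt : ta < t2)
    (hbig : PhiMax m n < (t2 - ta) * ((m - 1) / m / (4 * m)))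
    (hU1 : 0 < U1) (hU1' : U1 ≤ exp (2 * (ta - t1)) + 5 / m)
    (hP1 : -((m - 1) * Zf e t1) ≤ P1) (hP1' : P1 ≤ 5 / m) :
    ∃ (U P : ℝ → ℝ) (ts : ℝ), t1 < ts ∧ U t1 = U1 ∧ P t1 = P1 ∧
      (∀ t ∈ Ico t1 ts, IsSol m n e U P t ∧ |P t| ≤ 5 / m) ∧ Tendsto U (𝓝[<] ts) (𝓝 0) := by
  have h5 : 0 < 5 / m := by positivity
  set d := min U1 (5 / m) with hd
  have hd0 : 0 < d := lt_min hU1 h5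
  set δ : ℕ → ℝ := fun j => d / (j + 2) with hδdef
  have hδ0 : ∀ j, 0 < δ j := fun j => by simp only [hδdef]; positivity
  have hδd : ∀ j, δ j < d := fun j => by
    simp only [hδdef]
    apply div_lt_self hd0
    have : (0 : ℝ) ≤ j := Nat.cast_nonneg j
    linarith
  have hδanti : ∀ j i, j ≤ i → δ i ≤ δ j := fun j i h => by
    have : (j : ℝ) ≤ i := Nat.cast_le.2 h
    simp only [hδdef]; gcongr
  have hδlim : Tendsto δ atTop (𝓝 0) := by
    apply Tendsto.const_div_atTop
    exact tendsto_atTop_add_const_right _ _ tendsto_natCast_atTop_atTop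
  set u := exp (2 * (ta - t1)) + 5 / m with hu
  have hu0 : 0 < u := by positivity
  have hex := fun j : ℕ => fwd_k (n := n) hm hm2 hn he he1 h1a hta ht2 hlt hbig hU1' hP1 hP1' (hδ0 j)
    ((hδd j).trans_le (min_le_left _ _)) ((hδd j).trans_le (min_le_right _ _))
  choose y τ hτ1 hτ2 hy0 hy hbd hgt hle using hex
  have h12 : t1 ≤ t2 := h1a.trans hlt.le
  have hδu : ∀ j, δ j ≤ u := fun j => by
    have := exp_pos (2 * (ta - t1)); linarith [hδd j, min_le_right U1 (5 / m)]
  have hsolj : ∀ j, ∀ t ∈ Ico t1 (τ j), HasDerivAt (y j)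
      ((y j t).2 - 2 * (y j t).1, YP m n e t (y j t).1 (y j t).2) t := by
    intro j t ht
    have ht' : t ∈ Icc t1 t2 := ⟨ht.1, ht.2.le.trans (hτ2 j)⟩
    have h1 := hy j t ht'
    obtain ⟨b1, b2⟩ := hbd j t ht'
    unfold Fc at h1
    rwa [cl_eq ht', cl_eq b2, cl_eq ⟨(hgt j t ht).le, b1⟩] at h1
  have hagree : ∀ j i, j ≤ i → ∀ t ∈ Icc t1 (τ j), y j t = y i t := by
    intro j i hji t ht
    obtain ⟨K, hK⟩ := Fc_lip m n e t1 t2 (δ i) u (5 / m) h12 (hδ0 i) (hδu i) h5.le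
    have hKt : ∀ t, LipschitzWith K (Fc m n e t1 t2 (δ i) u (5 / m) t) := by
      intro t
      have := hK.comp (LipschitzWith.prodMk_left t)
      rw [mul_one] at this
      exact this
    have hsub : ∀ s ∈ Icc t1 (τ j), s ∈ Icc t1 t2 := fun s hs => ⟨hs.1, hs.2.trans (hτ2 j)⟩
    have := dist_le_of_trajectories_ODE (v := Fc m n e t1 t2 (δ i) u (5 / m)) (K := K)
      (f := y j) (g := y i) (a := t1) (b := τ j) (δ := 0) hKt
      (fun s hs => (hy j s (hsub s hs)).continuousAt.continuousWithinAt)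
      (fun s hs => by
        have hs' := hsub s (Ico_subset_Icc_self hs)
        have h1 := hsolj j s hs
        obtain ⟨b1, b2⟩ := hbd j s hs'
        have : Fc m n e t1 t2 (δ i) u (5 / m) s (y j s)
          = ((y j s).2 - 2 * (y j s).1, YP m n e s (y j s).1 (y j s).2) := by
          unfold Fc
          rw [cl_eq hs', cl_eq b2, cl_eq ⟨(hδanti j i hji).trans (hgt j s hs).le, b1⟩]
        rw [this]; exact h1.hasDerivWithinAt)
      (fun s hs => (hy i s (hsub s hs)).continuousAt.continuousWithinAt)
      (fun s hs => (hy i s (hsub s (Ico_subset_Icc_self hs))).hasDerivWithinAt)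
      (by rw [hy0, hy0]; simp) t ht
    rw [zero_mul] at this
    exact dist_le_zero.1 this
  have hτmono : ∀ j i, j ≤ i → τ j ≤ τ i := by
    intro j i hji
    by_contra h
    push Not at h
    have h1 := hle i
    have h2 := hgt j (τ i) ⟨(hτ1 i).le, h⟩
    rw [hagree j i hji (τ i) ⟨(hτ1 i).le, h.le⟩] at h2
    linarith [hδanti j i hji]
  have hbdd : BddAbove (range τ) := ⟨t2, by rintro _ ⟨j, rfl⟩; exact hτ2 j⟩
  set ts := ⨆ j, τ j with hts
  have hτts : ∀ j, τ j ≤ ts := fun j => le_ciSup hbdd j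
  have hchoose : ∀ t, ∃ k, t < ts → t < τ k := by
    intro t
    by_cases h : t < ts
    · obtain ⟨k, hk⟩ := exists_lt_of_lt_ciSup h
      exact ⟨k, fun _ => hk⟩
    · exact ⟨0, fun h' => absurd h' h⟩
  choose k hk using hchoose
  have hagree2 : ∀ j i, ∀ t, t1 ≤ t → t < τ j → t < τ i → y j t = y i t := by
    intro j i t h0 h1 h2
    rcases le_total j i with h | h
    · exact hagree j i h t ⟨h0, h1.le⟩
    · exact (hagree i j h t ⟨h0, h2.le⟩).symm
  let w : ℝ → ℝ × ℝ := fun t => if t < t1 then y 0 t else y (k t) t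
  have hw1 : ∀ t < t1, w t = y 0 t := fun t ht => if_pos ht
  have hw2 : ∀ j, ∀ t ∈ Ico t1 (τ j), w t = y j t := by
    intro j t ht
    have : w t = y (k t) t := if_neg (not_lt.2 ht.1)
    rw [this]
    exact hagree2 _ _ t ht.1 (hk t (ht.2.trans_le (hτts j))) ht.2
  have hloc : ∀ t ∈ Ico t1 ts, ∃ j, t ∈ Ico t1 (τ j) ∧ w =ᶠ[𝓝 t] y j := by
    intro t ht
    rcases ht.1.eq_or_lt with h | h
    · subst h
      refine ⟨0, ⟨le_rfl, hτ1 0⟩, ?_⟩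
      filter_upwards [Iio_mem_nhds (hτ1 0)] with s hs
      rcases lt_or_ge s t1 with h1 | h1
      · exact hw1 s h1
      · exact hw2 0 s ⟨h1, hs⟩
    · have hkt := hk t ht.2
      refine ⟨k t, ⟨ht.1, hkt⟩, ?_⟩
      filter_upwards [Ioo_mem_nhds h hkt] with s hs
      exact hw2 _ s ⟨hs.1.le, hs.2⟩
  have hpt : ∀ t ∈ Ico t1 ts, IsSol m n e (fun t => (w t).1) (fun t => (w t).2) t ∧
      |(w t).2| ≤ 5 / m := by
    intro t ht
    obtain ⟨j, hj, hwj⟩ := hloc t ht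
    have hj' : t ∈ Icc t1 t2 := ⟨hj.1, hj.2.le.trans (hτ2 j)⟩
    have hwt := hwj.self_of_nhds
    have hdv : HasDerivAt w ((w t).2 - 2 * (w t).1, YP m n e t (w t).1 (w t).2) t := by
      rw [hwt]; exact (hsolj j t hj).congr_of_eventuallyEq hwj
    refine ⟨⟨?_, hasDerivAt_fst hdv, hasDerivAt_snd hdv⟩, ?_⟩
    · change 0 < (w t).1
      rw [hwt]; exact (hδ0 j).trans (hgt j t hj)
    · rw [hwt]; exact abs_le.2 ((hbd j t hj').2)
  have hts1 : t1 < ts := (hτ1 0).trans_le (hτts 0)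
  have hwt1 : w t1 = (U1, P1) := by rw [hw2 0 t1 ⟨le_rfl, hτ1 0⟩, hy0]
  refine ⟨fun t => (w t).1, fun t => (w t).2, ts, hts1, by simp only [hwt1], by simp only [hwt1],
    hpt, ?_⟩
  set C := 5 / m + 2 * u with hC
  have hbound : ∀ t ∈ Ico t1 ts, (w t).1 ≤ C * (ts - t) := by
    intro t ht
    have hev : ∀ᶠ j in atTop, (w t).1 ≤ δ j + C * (ts - t) := by
      filter_upwards [eventually_ge_atTop (k t)] with j hj
      have htj : t < τ j := (hk t ht.2).trans_le (hτmono _ _ hj)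
      have hsub : ∀ s ∈ Icc t (τ j), s ∈ Icc t1 t2 := fun s hs =>
        ⟨ht.1.trans hs.1, hs.2.trans (hτ2 j)⟩
      have h1 := (convex_Icc t (τ j)).norm_image_sub_le_of_norm_hasDerivWithin_le
        (f := fun s => (y j s).1) (C := C) (x := τ j) (y := t)
        (fun s hs => (hasDerivAt_fst (hy j s (hsub s hs))).hasDerivWithinAt)
        (fun s hs => by
          have b1 := cl_mem (l := δ j) (u := u) (hδu j) (y j s).1
          have b2 := cl_mem (l := -(5 / m)) (u := 5 / m) (by linarith) (y j s).2
          have := hδ0 j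
          change |cl (-(5 / m)) (5 / m) (y j s).2 - 2 * cl (δ j) u (y j s).1| ≤ C
          rw [abs_le]
          constructor <;> linarith [b1.1, b1.2, b2.1, b2.2]) ⟨htj.le, le_rfl⟩ ⟨le_rfl, htj.le⟩
      rw [hw2 j t ⟨ht.1, htj⟩]
      have h2 := (le_abs_self _).trans h1
      have h3 := hle j
      rw [Real.norm_eq_abs, abs_sub_comm, abs_of_pos (by linarith : 0 < τ j - t)] at h2
      have h4 : C * (τ j - t) ≤ C * (ts - t) := by
        have := hτts j
        gcongr
      linarith
    have := (hδlim.add_const (C * (ts - t)))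
    rw [zero_add] at this
    exact ge_of_tendsto this hev
  have hmem : Ico t1 ts ∈ 𝓝[<] ts := Ico_mem_nhdsLT hts1
  refine squeeze_zero' (g := fun t => C * (ts - t)) ?_ ?_ ?_
  · filter_upwards [hmem] with t ht
    exact (hpt t ht).1.1.le
  · filter_upwards [hmem] with t ht
    exact hbound t ht
  · have : Tendsto (fun t => C * (ts - t)) (𝓝 ts) (𝓝 (C * (ts - ts))) :=
      (by fun_prop : Continuous fun t => C * (ts - t)).tendsto ts
    rw [sub_self, mul_zero] at this
    exact this.mono_left nhdsWithin_le_nhds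

lemma glue_deriv {f g : ℝ → ℝ} {f' t1 : ℝ} (hf : HasDerivAt f f' t1) (hg : HasDerivAt g f' t1)
    (hfg : f t1 = g t1) : HasDerivAt (fun t => if t ≤ t1 then f t else g t) f' t1 := by
  have h1 : HasDerivWithinAt (fun t => if t ≤ t1 then f t else g t) f' (Iic t1) t1 :=
    hf.hasDerivWithinAt.congr (fun t ht => if_pos ht) (if_pos le_rfl)
  have h2 : HasDerivWithinAt (fun t => if t ≤ t1 then f t else g t) f' (Ici t1) t1 := by
    refine hg.hasDerivWithinAt.congr (fun t ht => ?_) (by simp [hfg])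
    rcases (mem_Ici.1 ht).eq_or_lt with h | h
    · subst h; simp [hfg]
    · exact if_neg (not_le.2 h)
  have h3 := h1.union h2
  rw [Iic_union_Ici] at h3
  exact hasDerivWithinAt_univ.1 h3

theorem global_sol {m n e ta t2 t1 : ℝ} {U0 P0 : ℝ → ℝ} (hm : 1 < m) (hm2 : m < 2) (hn : 1 ≤ n)
    (he : 0 < e) (he1 : e < 1) (h1a : t1 ≤ ta)
    (hta : Zf e ta = 1 / (2 * m)) (ht2 : Zf e t2 = 1 / m) (hlt : ta < t2)
    (hbig : PhiMax m n < (t2 - ta) * ((m - 1) / m / (4 * m)))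
    (hs : ∀ t ≤ t1, IsSol m n e U0 P0 t)
    (hU1' : U0 t1 ≤ exp (2 * (ta - t1)) + 5 / m)
    (hP1 : -((m - 1) * Zf e t1) ≤ P0 t1) (hP1' : P0 t1 ≤ 5 / m) :
    ∃ (U P : ℝ → ℝ) (ts : ℝ), t1 < ts ∧ (∀ t < ts, IsSol m n e U P t) ∧
      (∀ t ≤ t1, U t = U0 t ∧ P t = P0 t) ∧
      (∀ t ∈ Ico t1 ts, |P t| ≤ 5 / m) ∧ Tendsto U (𝓝[<] ts) (𝓝 0) := by
  obtain ⟨U2, P2, ts, hts, hU2, hP2, hsol, hlim⟩ := fwd hm hm2 hn he he1 h1a hta ht2 hlt hbig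
    (hs t1 le_rfl).1 hU1' hP1 hP1'
  have hval1 : ∀ t ≤ t1, (if t ≤ t1 then U0 t else U2 t) = U0 t := fun t h => if_pos h
  have hval1' : ∀ t ≤ t1, (if t ≤ t1 then P0 t else P2 t) = P0 t := fun t h => if_pos h
  have hval2 : ∀ t, t1 ≤ t → (if t ≤ t1 then U0 t else U2 t) = U2 t := by
    intro t h
    rcases h.eq_or_lt with h | h
    · subst h; simp [hU2]
    · exact if_neg (not_le.2 h)
  have hval2' : ∀ t, t1 ≤ t → (if t ≤ t1 then P0 t else P2 t) = P2 t := by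
    intro t h
    rcases h.eq_or_lt with h | h
    · subst h; simp [hP2]
    · exact if_neg (not_le.2 h)
  refine ⟨fun t => if t ≤ t1 then U0 t else U2 t, fun t => if t ≤ t1 then P0 t else P2 t, ts, hts,
    ?_, fun t ht => ⟨hval1 t ht, hval1' t ht⟩, ?_, ?_⟩
  · intro t ht
    rcases lt_trichotomy t t1 with h | h | h
    · obtain ⟨a, b, c⟩ := hs t h.le
      refine ⟨by simpa [h.le] using a, ?_, ?_⟩
      · simp only [hval1 t h.le, hval1' t h.le]
        refine b.congr_of_eventuallyEq ?_
        filter_upwards [Iio_mem_nhds h] with s hs using hval1 s (le_of_lt hs)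
      · simp only [hval1 t h.le, hval1' t h.le]
        refine c.congr_of_eventuallyEq ?_
        filter_upwards [Iio_mem_nhds h] with s hs using hval1' s (le_of_lt hs)
    · subst h
      obtain ⟨a, b, c⟩ := hs t le_rfl
      obtain ⟨⟨a', b', c'⟩, -⟩ := hsol t ⟨le_rfl, ht⟩
      rw [hU2, hP2] at b' c'
      refine ⟨by simpa using a, ?_, ?_⟩
      · simp only [hval1 t le_rfl, hval1' t le_rfl]
        exact glue_deriv b b' hU2.symm
      · simp only [hval1 t le_rfl, hval1' t le_rfl]
        exact glue_deriv c c' hP2.symm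
    · obtain ⟨⟨a, b, c⟩, -⟩ := hsol t ⟨h.le, ht⟩
      refine ⟨by simpa [not_le.2 h] using a, ?_, ?_⟩
      · simp only [hval2 t h.le, hval2' t h.le]
        refine b.congr_of_eventuallyEq ?_
        filter_upwards [Ioi_mem_nhds h] with s hs using hval2 s (le_of_lt hs)
      · simp only [hval2 t h.le, hval2' t h.le]
        refine c.congr_of_eventuallyEq ?_
        filter_upwards [Ioi_mem_nhds h] with s hs using hval2' s (le_of_lt hs)
  · intro t ht
    simp only [hval2' t ht.1]
    exact (hsol t ht).2
  · refine hlim.congr' ?_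
    filter_upwards [Ico_mem_nhdsLT hts] with t ht using (hval2 t ht.1).symm

lemma contDiffOn_of_hasDerivAt {f f' : ℝ → ℝ} {s : Set ℝ} (hs : IsOpen s) {k : ℕ}
    (hd : ∀ x ∈ s, HasDerivAt f (f' x) x) (hf' : ContDiffOn ℝ k f' s) :
    ContDiffOn ℝ (k + 1) f s := by
  rw [contDiffOn_succ_iff_deriv_of_isOpen hs]
  refine ⟨fun x hx => (hd x hx).differentiableAt.differentiableWithinAt, ?_, ?_⟩
  · intro h
    exact absurd h (by simp)
  · exact hf'.congr fun x hx => (hd x hx).deriv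

noncomputable def gP (e : ℝ) (U : ℝ → ℝ) (x : ℝ) : ℝ := x ^ 2 * U (log x) / e

noncomputable def prof (e q f0 ts : ℝ) (U : ℝ → ℝ) (x : ℝ) : ℝ :=
  if x ≤ 0 then f0 else if x < exp ts then gP e U x ^ q else 0

theorem assemble {m p σ e q f0 ts t1 C : ℝ} {N : ℕ} {U P : ℝ → ℝ} (hm : 1 < m) (hp : m + p = 2)
    (he : 0 < e) (hσ : σ = 2 + e) (hq : q = 1 / (m - 1)) (h1s : t1 < ts)
    (hsol : ∀ t < ts, IsSol m N e U P t) (hC : ∀ t ∈ Ico t1 ts, |P t| ≤ C)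
    (hU : Tendsto U (𝓝[<] ts) (𝓝 0))
    (h0 : Tendsto (fun x => gP e U x ^ q) (𝓝[>] 0) (𝓝 f0)) :
    ProfileWithInterface N m p σ (prof e q f0 ts U) (exp ts) := by
  have hμ : 0 < m - 1 := by linarith
  have hq0 : 0 < q := by rw [hq]; positivity
  have hqμ : q * (m - 1) = 1 := by rw [hq]; field_simp
  have hval : ∀ x ∈ Ioo 0 (exp ts), prof e q f0 ts U x = gP e U x ^ q := by
    intro x hx
    unfold prof
    rw [if_neg (not_le.2 hx.1), if_pos hx.2]
  have hlog : ∀ x ∈ Ioo 0 (exp ts), log x < ts := fun x hx => (log_lt_iff_lt_exp hx.1).2 hx.2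
  have hgpos : ∀ x ∈ Ioo 0 (exp ts), 0 < gP e U x := by
    intro x hx
    have := (hsol _ (hlog x hx)).1
    have := hx.1
    unfold gP; positivity
  have hev : ∀ x ∈ Ioo 0 (exp ts), prof e q f0 ts U =ᶠ[𝓝 x] fun x => gP e U x ^ q := by
    intro x hx
    filter_upwards [Ioo_mem_nhds hx.1 hx.2] with y hy using hval y hy
  have hgd : ∀ x ∈ Ioo 0 (exp ts), HasDerivAt (gP e U) (x * P (log x) / e) x := by
    intro x hx
    have hx0 : x ≠ 0 := hx.1.ne'
    have h1 := (hsol _ (hlog x hx)).2.1.comp x (hasDerivAt_log hx0)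
    have h2 := ((hasDerivAt_pow 2 x).mul h1).div_const e
    refine h2.congr_deriv ?_
    simp only [Function.comp]
    field_simp
    push_cast
    ring
  have hfd : ∀ x ∈ Ioo 0 (exp ts), HasDerivAt (prof e q f0 ts U)
      (x * P (log x) / e * q * gP e U x ^ (q - 1)) x := by
    intro x hx
    exact ((hgd x hx).rpow_const (Or.inl (hgpos x hx).ne')).congr_of_eventuallyEq (hev x hx)
  have hpw : ∀ x ∈ Ioo 0 (exp ts), prof e q f0 ts U x ^ m = gP e U x ^ (q + 1) := by
    intro x hx
    rw [hval x hx, ← rpow_mul (hgpos x hx).le]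
    congr 1
    linarith
  have hmd : ∀ x ∈ Ioo 0 (exp ts), HasDerivAt (fun x => prof e q f0 ts U x ^ m)
      (x * P (log x) / e * (q + 1) * gP e U x ^ q) x := by
    intro x hx
    have h1 := (hgd x hx).rpow_const (p := q + 1) (Or.inl (hgpos x hx).ne')
    rw [add_sub_cancel_right] at h1
    refine h1.congr_of_eventuallyEq ?_
    filter_upwards [Ioo_mem_nhds hx.1 hx.2] with y hy using hpw y hy
  have hmd2 : ∀ x ∈ Ioo 0 (exp ts), HasDerivAt (deriv fun x => prof e q f0 ts U x ^ m)
      ((P (log x) + YP m N e (log x) (U (log x)) (P (log x))) / e * (q + 1) * gP e U x ^ q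
        + x * P (log x) / e * (q + 1) * (x * P (log x) / e * q * gP e U x ^ (q - 1))) x := by
    intro x hx
    have hx0 : x ≠ 0 := hx.1.ne'
    have h1 := (hsol _ (hlog x hx)).2.2.comp x (hasDerivAt_log hx0)
    have h2 := ((((hasDerivAt_id x).mul h1).div_const e).mul_const (q + 1)).mul
      ((hgd x hx).rpow_const (p := q) (Or.inl (hgpos x hx).ne'))
    have h3 : (deriv fun x => prof e q f0 ts U x ^ m) =ᶠ[𝓝 x]
        fun x => x * P (log x) / e * (q + 1) * gP e U x ^ q := by
      filter_upwards [Ioo_mem_nhds hx.1 hx.2] with y hy using (hmd y hy).deriv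
    refine (h2.congr_of_eventuallyEq h3).congr_deriv ?_
    simp only [Function.comp, id]
    have : x * (YP m N e (log x) (U (log x)) (P (log x)) * x⁻¹) =
        YP m N e (log x) (U (log x)) (P (log x)) := by field_simp
    rw [this]
    simp only [Pi.mul_apply, Function.comp, id]
    ring
  have hlogt : Tendsto log (𝓝[<] (exp ts)) (𝓝[<] ts) := by
    rw [tendsto_nhdsWithin_iff]
    constructor
    · have := (continuousAt_log (exp_pos ts).ne').tendsto
      rw [log_exp] at this
      exact this.mono_left nhdsWithin_le_nhds
    · filter_upwards [Ioo_mem_nhdsLT (exp_pos ts)] with x hx using hlog x hx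
  have hgq0 : Tendsto (fun x => gP e U x ^ q) (𝓝[<] (exp ts)) (𝓝 0) := by
    have h1 : Tendsto (gP e U) (𝓝[<] (exp ts)) (𝓝 ((exp ts) ^ 2 * 0 / e)) := by
      unfold gP
      refine Tendsto.div_const (Tendsto.mul ?_ (hU.comp hlogt)) e
      exact ((continuous_pow 2).tendsto _).mono_left nhdsWithin_le_nhds
    rw [mul_zero, zero_div] at h1
    have h2 := h1.rpow_const (p := q) (Or.inr hq0.le)
    rwa [zero_rpow hq0.ne'] at h2
  have hξ : (0 : ℝ) < exp ts := exp_pos ts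
  refine ⟨hξ, ?_, ?_, ?_, ?_, ?_, ?_⟩
  · intro x hx
    rcases hx.1.eq_or_lt with h | h
    · subst h
      have : ContinuousWithinAt (prof e q f0 ts U) (Ioi 0) 0 := by
        have hf0 : prof e q f0 ts U 0 = f0 := by simp [prof]
        unfold ContinuousWithinAt
        rw [hf0]
        refine h0.congr' ?_
        filter_upwards [Ioo_mem_nhdsGT hξ] with y hy using (hval y hy).symm
      exact (continuousWithinAt_Ioi_iff_Ici.1 this).mono fun y hy => hy.1
    · rcases hx.2.eq_or_lt with h' | h'
      · subst h'
        have : ContinuousWithinAt (prof e q f0 ts U) (Iio (exp ts)) (exp ts) := by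
          have hf0 : prof e q f0 ts U (exp ts) = 0 := by simp [prof, not_le.2 hξ]
          unfold ContinuousWithinAt
          rw [hf0]
          refine hgq0.congr' ?_
          filter_upwards [Ioo_mem_nhdsLT hξ] with y hy using (hval y hy).symm
        exact (continuousWithinAt_Iio_iff_Iic.1 this).mono fun y hy => hy.2
      · exact (hfd x ⟨h, h'⟩).continuousAt.continuousWithinAt
  · intro x hx
    rw [hval x hx]
    exact rpow_pos_of_pos (hgpos x hx) _
  · have hPc : ContinuousOn P (Iio ts) := fun t ht => (hsol t ht).2.2.continuousAt.continuousWithinAt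
    have hUc : ContinuousOn U (Iio ts) := fun t ht => (hsol t ht).2.1.continuousAt.continuousWithinAt
    have hYc : ContinuousOn (fun t => YP m N e t (U t) (P t)) (Iio ts) := by
      have hne : ∀ t ∈ Iio ts, U t ≠ 0 := fun t ht => (hsol t ht).1.ne'
      unfold YP Zf
      refine ContinuousOn.add (ContinuousOn.sub (ContinuousOn.div (by fun_prop) hUc hne)
        (by fun_prop)) (by fun_prop)
    have hP1 : ContDiffOn ℝ 1 P (Iio ts) := by
      have := contDiffOn_of_hasDerivAt (k := 0) isOpen_Iio (fun t ht => (hsol t ht).2.2)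
        (contDiffOn_zero.2 hYc : ContDiffOn ℝ ((0 : ℕ) : WithTop ℕ∞) _ _)
      have h2 : ((0 : ℕ) : WithTop ℕ∞) + 1 = 1 := by norm_num
      rwa [h2] at this
    have hU1 : ContDiffOn ℝ 1 U (Iio ts) := by
      have := contDiffOn_of_hasDerivAt (k := 0) isOpen_Iio (fun t ht => (hsol t ht).2.1)
        (by
          have : ContinuousOn (fun t => P t - 2 * U t) (Iio ts) := by fun_prop
          exact (contDiffOn_zero.2 this : ContDiffOn ℝ ((0 : ℕ) : WithTop ℕ∞) _ _))
      have h2 : ((0 : ℕ) : WithTop ℕ∞) + 1 = 1 := by norm_num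
      rwa [h2] at this
    have hU2 : ContDiffOn ℝ 2 U (Iio ts) := by
      have := contDiffOn_of_hasDerivAt (k := 1) isOpen_Iio (fun t ht => (hsol t ht).2.1)
        (by simpa using hP1.sub (contDiffOn_const.mul hU1))
      have h2 : ((1 : ℕ) : WithTop ℕ∞) + 1 = 2 := by norm_num
      rwa [h2] at this
    have hlg : ContDiffOn ℝ 2 log (Ioo 0 (exp ts)) := fun x hx =>
      (contDiffAt_log.2 hx.1.ne').contDiffWithinAt
    have hg2 : ContDiffOn ℝ 2 (gP e U) (Ioo 0 (exp ts)) := by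
      unfold gP
      have h1 : ContDiffOn ℝ 2 (fun x => U (log x)) (Ioo 0 (exp ts)) := hU2.comp hlg hlog
      exact ((contDiff_id.pow 2).contDiffOn.mul h1).div_const e
    exact (hg2.rpow_const_of_ne fun x hx => (hgpos x hx).ne').congr hval
  · intro x hx
    unfold SSODE
    rw [(hmd2 x hx).deriv, (hmd x hx).deriv, (hfd x hx).deriv, hval x hx]
    have hgp := hgpos x hx
    have hx0 := hx.1
    have hU0 := (hsol _ (hlog x hx)).1
    have e1 : (gP e U x ^ q) ^ p = gP e U x ^ (q - 1) := by
      rw [← rpow_mul hgp.le]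
      congr 1
      have : p = 2 - m := by linarith
      rw [this]; linarith
    have e2 : gP e U x ^ q = gP e U x ^ (q - 1) * gP e U x := by
      have := rpow_add hgp (q - 1) 1
      rw [rpow_one, sub_add_cancel] at this
      exact this
    have e3 : x ^ σ = x ^ 2 * exp (e * log x) := by
      rw [hσ, rpow_add hx0, rpow_def_of_pos hx0 e, mul_comm (log x)]
      norm_num
    have hL : σ * (m - 1) + 2 * (p - 1) = e * (m - 1) := by
      rw [hσ, show p = 2 - m by linarith]; ring
    have e4 : alphaC m p σ = (4 + e) * q / e := by
      unfold alphaC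
      rw [hL, hσ, hq]; field_simp; ring
    have e5 : betaC m p σ = 2 / e := by
      unfold betaC
      rw [hL, show p = 2 - m by linarith]; field_simp; ring
    have hY : U (log x) * YP m N e (log x) (U (log x)) (P (log x)) =
      -(q * (P (log x)) ^ 2 + (2 / m) * P (log x) + (m - 1) / m * Zf e (log x))
        - N * U (log x) * P (log x) + (4 + e) / m * U (log x) := by
      unfold YP; rw [← hq]; field_simp
    have hZ : exp (e * log x) = Zf e (log x) / e ^ 2 := by
      unfold Zf; field_simp
    rw [e1, e2, e3, e4, e5, hZ]
    generalize gP e U x ^ (q - 1) = G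
    rw [show gP e U x = x ^ 2 * U (log x) / e from rfl]
    generalize YP m N e (log x) (U (log x)) (P (log x)) = Y at *
    generalize Zf e (log x) = Z at *
    generalize P (log x) = Pv at *
    generalize U (log x) = Uv at *
    have hmq : q + 1 = m * q := by linarith
    have hfin : (q + 1) * (q * Pv ^ 2 + Uv * Pv + Uv * Y + ((N : ℝ) - 1) * Uv * Pv)
        - (4 + e) * q * Uv + 2 * q * Pv + Z = 0 := by
      rw [hY, hmq]
      have hm0 : m ≠ 0 := by positivity
      field_simp
      linear_combination (-Z) * hqμ
    have : (Pv + Y) / e * (q + 1) * (G * (x ^ 2 * Uv / e)) +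
          x * Pv / e * (q + 1) * (x * Pv / e * q * G) +
        ((N : ℝ) - 1) / x * (x * Pv / e * (q + 1) * (G * (x ^ 2 * Uv / e))) -
      (4 + e) * q / e * (G * (x ^ 2 * Uv / e)) + 2 / e * x * (x * Pv / e * q * G) +
      x ^ 2 * (Z / e ^ 2) * G = G * x ^ 2 / e ^ 2 * ((q + 1) * (q * Pv ^ 2 + Uv * Pv + Uv * Y
        + ((N : ℝ) - 1) * Uv * Pv) - (4 + e) * q * Uv + 2 * q * Pv + Z) := by
      field_simp
      ring
    rw [this, hfin, mul_zero]
  · simp [prof, not_le.2 hξ]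
  · have h1 : Tendsto (fun x => (x * P (log x) / e * (q + 1)) * gP e U x ^ q)
        (𝓝[<] (exp ts)) (𝓝 0) := by
      apply bdd_le_mul_tendsto_zero' (exp ts * C / e * (q + 1)) _ hgq0
      have hl : ∀ᶠ x in 𝓝[<] (exp ts), log x ∈ Ico t1 ts := hlogt (Ico_mem_nhdsLT h1s)
      filter_upwards [Ioo_mem_nhdsLT hξ, hl] with x hx hxl
      have hb := hC _ hxl
      rw [abs_mul, abs_div, abs_mul, abs_of_pos hx.1, abs_of_pos he, abs_of_pos (by linarith : 0 < q + 1)]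
      have := hx.2.le
      gcongr
    refine h1.congr' ?_
    filter_upwards [Ioo_mem_nhdsLT hξ] with x hx using (hmd x hx).deriv.symm

lemma hasDerivAt_expc (k t : ℝ) : HasDerivAt (fun t => exp (k * t)) (k * exp (k * t)) t := by
  have := ((hasDerivAt_id t).const_mul k).exp
  refine this.congr_deriv ?_
  simp only [id]; ring

lemma tendsto_expc {k : ℝ} (hk : 0 < k) : Tendsto (fun t => exp (k * t)) atBot (𝓝 0) :=
  tendsto_exp_atBot.comp (tendsto_id.const_mul_atBot hk)

lemma V_id {m n e t U P q : ℝ} (hU : 0 < U) (hq : q = 1 / (m - 1)) (hm : 1 < m) :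
    U * (YP m n e t U P - 2 * (P - 2 * U)) =
      -(q * (P - 2 * U) ^ 2 + (4 * q + n + 2) * U * (P - 2 * U) + (4 * q + 2 * n) * U ^ 2
        + 2 / m * (P - 2 * U) - e / m * U + (m - 1) / m * Zf e t) := by
  have hY : U * YP m n e t U P =
      -(q * P ^ 2 + (2 / m) * P + (m - 1) / m * Zf e t) - n * U * P + (4 + e) / m * U := by
    unfold YP; rw [← hq]; field_simp
  rw [mul_sub, hY]
  ring

theorem back1 {m n e ta : ℝ} (hm : 1 < m) (hm2 : m < 2) (hn : 1 ≤ n) (he : 0 < e) (he1 : e < 1)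
    (hta : Zf e ta = 1 / (2 * m)) :
    ∃ t1 ≤ ta, ∃ U P : ℝ → ℝ, (∀ t ≤ t1, IsSol m n e U P t) ∧
      U t1 ≤ exp (2 * (ta - t1)) + 5 / m ∧ -((m - 1) * Zf e t1) ≤ P t1 ∧ P t1 ≤ 5 / m ∧
      Tendsto (fun t => U t - exp (2 * ta) * exp (-2 * t)) atBot (𝓝 ((4 + e) / (m * n) / 2)) := by
  have hμ : 0 < m - 1 := by linarith
  have hm0 : 0 < m := by linarith
  have hn0 : 0 < n := by linarith
  set q := 1 / (m - 1) with hq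
  have hq0 : 0 < q := by positivity
  set ps := (4 + e) / (m * n) with hps
  have hps0 : 0 < ps := by positivity
  have hnps : n * ps = (4 + e) / m := by rw [hps]; field_simp
  have hps5 : ps ≤ 5 / m := by
    have : ps ≤ n * ps := le_mul_of_one_le_left hps0.le hn
    have h2 : (4 + e) / m ≤ 5 / m := by gcongr; linarith
    linarith
  set A := exp (2 * ta) with hA
  have hA0 : 0 < A := exp_pos _
  set R := q * ps ^ 2 + 2 / m * ps + 1 with hR
  have hR0 : 0 < R := by positivity
  set C := R / A with hC
  have hC0 : 0 < C := by positivity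
  have hCA : C * A = R := by rw [hC]; field_simp
  have hx0 := tendsto_expc (k := 2) (by norm_num)
  have hx1 : Tendsto (fun t => C * exp (2 * t)) atBot (𝓝 0) := by simpa using hx0.const_mul C
  obtain ⟨t1, ⟨ht1a, ht1b⟩, ht1c⟩ := (((eventually_le_atBot ta).and
    (hx0.eventually (eventually_le_nhds (by norm_num : (0 : ℝ) < 1)))).and
    (hx1.eventually (eventually_le_nhds (by positivity : 0 < ps / 2)))).exists
  have hmono : ∀ t ≤ t1, exp (2 * t) ≤ exp (2 * t1) := fun t ht => exp_le_exp.2 (by linarith)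
  have hsm : ∀ t ≤ t1, C * exp (2 * t) ≤ ps / 2 := fun t ht =>
    (mul_le_mul_of_nonneg_left (hmono t ht) hC0.le).trans ht1c
  have hinv : ∀ t, exp (-2 * t) * exp (2 * t) = 1 := fun t => by
    rw [← exp_add]; simp
  have hZ1 : ∀ t ≤ t1, Zf e t ≤ 1 := by
    intro t ht
    have h1 : Zf e t ≤ 1 / (2 * m) := hta ▸ Zf_mono he (ht.trans ht1a)
    have : 1 / (2 * m) ≤ 1 := by rw [div_le_one (by positivity)]; linarith
    linarith
  have hc1 : (m - 1) / m ≤ 1 := by rw [div_le_one hm0]; linarith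
  obtain ⟨U, P, hUP⟩ := back_exists (m := m) (n := n) (e := e) (θ := 0) (t1 := t1)
    (l1 := fun t => A * exp (-2 * t) + ps / 2 - C * exp (2 * t))
    (u1 := fun t => A * exp (-2 * t) + ps / 2 + exp (2 * t))
    (l2 := fun t => ps - C * exp (2 * t)) (u2 := fun _ => ps)
    (l1' := fun t => A * (-2 * exp (-2 * t)) - C * (2 * exp (2 * t)))
    (u1' := fun t => A * (-2 * exp (-2 * t)) + 2 * exp (2 * t))
    (l2' := fun t => - (C * (2 * exp (2 * t)))) (u2' := fun _ => 0)
    (fun t => (((hasDerivAt_expc (-2) t).const_mul A).add_const _).sub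
      ((hasDerivAt_expc 2 t).const_mul C))
    (fun t => (((hasDerivAt_expc (-2) t).const_mul A).add_const _).add (hasDerivAt_expc 2 t))
    (fun t => ((hasDerivAt_expc 2 t).const_mul C).const_sub _)
    (fun t => hasDerivAt_const t _)
    (fun t ht => by
      have := hsm t ht
      have : 0 < A * exp (-2 * t) := by positivity
      linarith)
    (fun t ht => by
      have := exp_pos (2 * t)
      have : 0 < C * exp (2 * t) := by positivity
      linarith)
    (fun t ht => by
      have : 0 < C * exp (2 * t) := by positivity
      linarith)
    (by
      rintro t ht U P ⟨b1, b2, b3, b4⟩ h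
      have : 0 < C * exp (2 * t) := by positivity
      rw [zero_mul, sub_zero] at b3 b4
      simp only at b3 ⊢
      rw [h]
      linarith)
    (by
      rintro t ht U P ⟨b1, b2, b3, b4⟩ h
      have := exp_pos (2 * t)
      rw [zero_mul, sub_zero] at b3 b4
      rw [h]
      linarith)
    (by
      rintro t ht U P ⟨b1, b2, b3, b4⟩ h
      rw [zero_mul, sub_zero] at b3 b4 h ⊢
      simp only at b1 b2 b3 b4 h ⊢
      have h1 := hsm t ht
      have hx := exp_pos (2 * t)
      have hCx : 0 < C * exp (2 * t) := by positivity
      have hU : A * exp (-2 * t) ≤ U := by linarith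
      have hU0 : 0 < U := lt_of_lt_of_le (by positivity) hU
      have hP0 : 0 ≤ P := by linarith
      have hz := Zf_pos he t
      have hnum : q * P ^ 2 + 2 / m * P + (m - 1) / m * Zf e t ≤ R := by
        have a1 : q * P ^ 2 ≤ q * ps ^ 2 := by gcongr
        have a2 : 2 / m * P ≤ 2 / m * ps := by gcongr
        have a3 : (m - 1) / m * Zf e t ≤ 1 * 1 :=
          mul_le_mul hc1 (hZ1 t ht) hz.le (by norm_num)
        linarith
      have hRU : R ≤ C * exp (2 * t) * U := by
        calc R = C * exp (2 * t) * (A * exp (-2 * t)) := by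
              rw [← hCA]
              linear_combination (-(C * A)) * hinv t
          _ ≤ _ := by gcongr
      have hdiv : (q * P ^ 2 + 2 / m * P + (m - 1) / m * Zf e t) / U ≤ C * exp (2 * t) := by
        rw [div_le_iff₀ hU0]; linarith
      unfold YP
      rw [← hq, neg_div, ← hnps, h]
      rw [h] at hdiv
      have : C * exp (2 * t) ≤ n * (C * exp (2 * t)) := le_mul_of_one_le_left hCx.le hn
      linarith)
    (by
      rintro t ht U P ⟨b1, b2, b3, b4⟩ h
      rw [zero_mul, sub_zero] at b3 b4 h ⊢
      simp only at b1 b2 b3 b4 h ⊢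
      have h1 := hsm t ht
      have hU0 : 0 < U := by
        have : 0 < A * exp (-2 * t) := by positivity
        linarith
      have hz := Zf_pos he t
      unfold YP
      rw [← hq, neg_div, ← hnps, h]
      have : 0 < (q * ps ^ 2 + 2 / m * ps + (m - 1) / m * Zf e t) / U := by positivity
      linarith)
  refine ⟨t1, ht1a, U, P, fun t ht => (hUP t ht).2, ?_, ?_, ?_, ?_⟩
  · have h := (hUP t1 le_rfl).1.2.1
    simp only at h
    have h2 : exp (2 * (ta - t1)) = A * exp (-2 * t1) := by
      rw [hA, ← exp_add]; congr 1; ring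
    have h3 : 1 ≤ 5 / m / 2 := by
      rw [div_div, le_div_iff₀ (by positivity)]; linarith
    rw [h2]
    linarith
  · have h := (hUP t1 le_rfl).1.2.2.1
    rw [zero_mul, sub_zero] at h
    simp only at h
    have := mul_pos hμ (Zf_pos he t1)
    linarith
  · have h := (hUP t1 le_rfl).1.2.2.2
    rw [zero_mul, sub_zero] at h
    linarith
  · have g1 : Tendsto (fun t => ps / 2 - C * exp (2 * t)) atBot (𝓝 (ps / 2)) := by
      simpa using hx1.const_sub (ps / 2)
    have g2 : Tendsto (fun t => ps / 2 + exp (2 * t)) atBot (𝓝 (ps / 2)) := by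
      simpa using hx0.const_add (ps / 2)
    refine tendsto_of_tendsto_of_tendsto_of_le_of_le' g1 g2 ?_ ?_
    · filter_upwards [eventually_le_atBot t1] with t ht
      have h := (hUP t ht).1.1
      simp only at h
      linarith
    · filter_upwards [eventually_le_atBot t1] with t ht
      have h := (hUP t ht).1.2.1
      simp only at h
      linarith

theorem back2 {m n e ta : ℝ} (hm : 1 < m) (hm2 : m < 2) (hn : 1 ≤ n) (he : 0 < e) (he1 : e < 1) :
    ∃ t1 ≤ ta, ∃ U P : ℝ → ℝ, (∀ t ≤ t1, IsSol m n e U P t) ∧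
      U t1 ≤ exp (2 * (ta - t1)) + 5 / m ∧ -((m - 1) * Zf e t1) ≤ P t1 ∧ P t1 ≤ 5 / m ∧
      Tendsto U atBot (𝓝 (e / (m * (4 * (1 / (m - 1)) + 2 * n)))) := by
  have hμ : 0 < m - 1 := by linarith
  have hm0 : 0 < m := by linarith
  have hn0 : 0 < n := by linarith
  set q := 1 / (m - 1) with hq
  have hq0 : 0 < q := by positivity
  have hq1 : 1 < q := by rw [hq, lt_div_iff₀ hμ]; linarith
  have hqμ : q * (m - 1) = 1 := by rw [hq]; field_simp
  set b := 4 * q + 2 * n with hb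
  have hb0 : 0 < b := by positivity
  set us := e / (m * b) with hus
  have hus0 : 0 < us := by positivity
  have hbus : b * us = e / m := by rw [hus]; field_simp
  have hus1 : us ≤ 1 / m / 6 := by
    rw [hus, div_div]
    apply div_le_div₀ (by norm_num) he1.le (by positivity)
    gcongr; linarith
  -- s = (m-1)/e * Z
  have hsd : ∀ t, HasDerivAt (fun t => (m - 1) * e * exp (e * t)) (e * ((m - 1) * e * exp (e * t))) t := by
    intro t
    refine ((hasDerivAt_expc e t).const_mul ((m - 1) * e)).congr_deriv ?_
    ring
  set s : ℝ → ℝ := fun t => (m - 1) * e * exp (e * t) with hs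
  have hs0 : ∀ t, 0 < s t := fun t => by simp only [hs]; positivity
  have hsZ : ∀ t, (m - 1) * Zf e t = e * s t := fun t => by simp only [hs, Zf]; ring
  have hslim : Tendsto s atBot (𝓝 0) := by
    simpa using (tendsto_expc he).const_mul ((m - 1) * e)
  have hZlim : Tendsto (Zf e) atBot (𝓝 0) := by
    have := (tendsto_expc he).const_mul (e ^ 2)
    rw [mul_zero] at this
    exact this
  obtain ⟨t1, ⟨ht1a, ht1b⟩, ht1c⟩ := (((eventually_le_atBot ta).and
    (hslim.eventually (eventually_le_nhds (by positivity : 0 < us / 8)))).and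
    (hZlim.eventually (eventually_le_nhds (by positivity : 0 < 1 / m / 8)))).exists
  have hsm : ∀ t ≤ t1, s t ≤ us / 8 := by
    intro t ht
    refine le_trans ?_ ht1b
    simp only [hs]
    gcongr
  have hZs : ∀ t ≤ t1, Zf e t ≤ 1 / m / 8 := fun t ht => (Zf_mono he ht).trans ht1c
  obtain ⟨U, P, hUP⟩ := back_exists (m := m) (n := n) (e := e) (θ := 2) (t1 := t1)
    (l1 := fun t => us - 5 / 4 * s t) (u1 := fun t => us + 1 / 2 * s t)
    (l2 := fun t => -(e * s t)) (u2 := fun t => e / 4 * s t)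
    (l1' := fun t => -(5 / 4 * (e * s t))) (u1' := fun t => 1 / 2 * (e * s t))
    (l2' := fun t => -(e * (e * s t))) (u2' := fun t => e / 4 * (e * s t))
    (fun t => ((hsd t).const_mul (5 / 4)).const_sub us)
    (fun t => ((hsd t).const_mul (1 / 2)).const_add us)
    (fun t => ((hsd t).const_mul e).neg)
    (fun t => (hsd t).const_mul (e / 4))
    (fun t ht => by have := hsm t ht; linarith)
    (fun t ht => by have := hs0 t; linarith)
    (fun t ht => by have := mul_pos he (hs0 t); linarith)
    (by
      rintro t ht U P ⟨b1, b2, b3, b4⟩ h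
      have := mul_pos he (hs0 t)
      linarith)
    (by
      rintro t ht U P ⟨b1, b2, b3, b4⟩ h
      have := mul_pos he (hs0 t)
      linarith)
    (by
      rintro t ht U P ⟨b1, b2, b3, b4⟩ h
      simp only at b1 b2 b3 b4 h ⊢
      have h1 := hsm t ht
      have hst := hs0 t
      have hes := mul_pos he hst
      have hz := hZs t ht
      have hU0 : 0 < U := by linarith
      have hid := V_id (n := n) (e := e) (t := t) (P := P) hU0 hq hm
      rw [h] at hid
      have hx : (m - 1) / m * Zf e t = e * s t / m := by rw [← hsZ]; ring
      have e1 : q * (-(e * s t)) ^ 2 = e * s t * Zf e t := by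
        have : q * (-(e * s t)) ^ 2 = e * s t * (q * (e * s t)) := by ring
        rw [this, ← hsZ, ← mul_assoc q, hqμ, one_mul]
      have e2 : e * s t * Zf e t ≤ e * s t * (1 / m / 8) := by gcongr
      have e3 : b * U * (U - us) ≤ b * (us * (17 / 16)) * (s t / 2) := by
        have c1 : b * U * (U - us) ≤ b * U * (s t / 2) := by
          apply mul_le_mul_of_nonneg_left _ (by positivity); linarith
        have c2 : b * U * (s t / 2) ≤ b * (us * (17 / 16)) * (s t / 2) := by
          gcongr; linarith
        linarith
      have e4 : b * (us * (17 / 16)) * (s t / 2) = e * s t * (1 / m) * (17 / 32) := by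
        have : b * (us * (17 / 16)) * (s t / 2) = (b * us) * s t * (17 / 32) := by ring
        rw [this, hbus]; ring
      have e5 : 0 < (4 * q + n + 2) * U * (e * s t) := by positivity
      have e6 : 0 < e * s t * (1 / m) := by positivity
      have e7 : e / m * U = b * us * U := by rw [hbus]
      have e8 : 0 < U * (e * (e * s t)) := by positivity
      rw [hx, e1, e7] at hid
      have hfin : 0 < U * (YP m n e t U P - 2 * (P - 2 * U) + e * (e * s t)) := by
        rw [mul_add, h, hid]
        have : 2 / m * (-(e * s t)) + e * s t / m = -(e * s t * (1 / m)) := by ring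
        linarith
      have := (mul_pos_iff_of_pos_left hU0).1 hfin
      linarith)
    (by
      rintro t ht U P ⟨b1, b2, b3, b4⟩ h
      simp only at b1 b2 b3 b4 h ⊢
      have h1 := hsm t ht
      have hst := hs0 t
      have hes := mul_pos he hst
      have hU0 : 0 < U := by linarith
      have hid := V_id (n := n) (e := e) (t := t) (P := P) hU0 hq hm
      rw [h] at hid
      have hx : (m - 1) / m * Zf e t = e * s t / m := by rw [← hsZ]; ring
      have e1 : 0 < q * (e / 4 * s t) ^ 2 := by positivity
      have e3 : b * U * (us - U) ≤ b * (us * (17 / 16)) * (5 / 4 * s t) := by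
        have c1 : b * U * (us - U) ≤ b * U * (5 / 4 * s t) := by
          apply mul_le_mul_of_nonneg_left _ (by positivity); linarith
        have c2 : b * U * (5 / 4 * s t) ≤ b * (us * (17 / 16)) * (5 / 4 * s t) := by
          gcongr; linarith
        linarith
      have e4 : b * (us * (17 / 16)) * (5 / 4 * s t) = e * s t * (1 / m) * (85 / 64) := by
        have : b * (us * (17 / 16)) * (5 / 4 * s t) = (b * us) * s t * (85 / 64) := by ring
        rw [this, hbus]; ring
      have e5 : 0 < (4 * q + n + 2) * U * (e / 4 * s t) := by positivity
      have e6 : 0 < e * s t * (1 / m) := by positivity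
      have e7 : e / m * U = b * us * U := by rw [hbus]
      have e8 : 0 < U * (e / 4 * (e * s t)) := by positivity
      rw [hx, e7] at hid
      have hfin : 0 < U * (e / 4 * (e * s t) - (YP m n e t U P - 2 * (P - 2 * U))) := by
        rw [mul_sub, h, hid]
        have : 2 / m * (e / 4 * s t) + e * s t / m = e * s t * (1 / m) * (3 / 2) := by ring
        linarith
      have := (mul_pos_iff_of_pos_left hU0).1 hfin
      linarith)
  have h5m : 5 / m = 5 * (1 / m) := by ring
  have hm1 : 0 < 1 / m := by positivity
  refine ⟨t1, ht1a, U, P, fun t ht => (hUP t ht).2, ?_, ?_, ?_, ?_⟩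
  · have h := (hUP t1 le_rfl).1.2.1
    simp only at h
    have := exp_pos (2 * (ta - t1))
    linarith
  · have h := (hUP t1 le_rfl).1.2.2.1
    have := (hUP t1 le_rfl).2.1
    simp only at h
    rw [hsZ]
    linarith
  · have h := (hUP t1 le_rfl).1.2.2.2
    have h' := (hUP t1 le_rfl).1.2.1
    simp only at h h'
    have : e / 4 * s t1 ≤ 1 / 4 * s t1 := by
      have := hs0 t1
      gcongr
    linarith
  · have g1 : Tendsto (fun t => us - 5 / 4 * s t) atBot (𝓝 us) := by
      simpa using (hslim.const_mul (5 / 4)).const_sub us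
    have g2 : Tendsto (fun t => us + 1 / 2 * s t) atBot (𝓝 us) := by
      have := (hslim.const_mul (1 / 2)).const_add us
      rw [mul_zero, add_zero] at this
      exact this
    refine tendsto_of_tendsto_of_tendsto_of_le_of_le' g1 g2 ?_ ?_
    · filter_upwards [eventually_le_atBot t1] with t ht using (hUP t ht).1.1
    · filter_upwards [eventually_le_atBot t1] with t ht using (hUP t ht).1.2.1

theorem back3 {m n e ta : ℝ} (hm : 1 < m) (hm2 : m < 2) (hn : 1 ≤ n) (he : 0 < e) (he1 : e < 1) :
    ∃ t1 ≤ ta, ∃ U P : ℝ → ℝ, (∀ t ≤ t1, IsSol m n e U P t) ∧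
      U t1 ≤ exp (2 * (ta - t1)) + 5 / m ∧ -((m - 1) * Zf e t1) ≤ P t1 ∧ P t1 ≤ 5 / m ∧
      Tendsto (fun t => U t * exp (-(e / 2) * t)) atBot (𝓝 1) := by
  have hμ : 0 < m - 1 := by linarith
  have hm0 : 0 < m := by linarith
  have hn0 : 0 < n := by linarith
  set q := 1 / (m - 1) with hq
  have hq0 : 0 < q := by positivity
  set a := 4 * q + n + 2 with ha
  set b := 4 * q + 2 * n with hb
  have ha0 : 0 < a := by positivity
  have hb0 : 0 < b := by positivity
  set D := q + 2 * a + 4 * b + 2 with hD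
  have hD0 : 2 < D := by linarith
  have hDpos : 0 < D := by linarith
  set D2 := 4 * D / e with hD2
  have hD20 : 0 < D2 := by positivity
  have hD2e : D2 * e = 4 * D := by rw [hD2]; field_simp
  have hD28 : 8 ≤ D2 := by
    have : D2 * e ≤ D2 := mul_le_of_le_one_right hD20.le he1.le
    linarith
  have hEd : ∀ t, HasDerivAt (fun t => exp (e / 2 * t)) (e / 2 * exp (e / 2 * t)) t := fun t =>
    hasDerivAt_expc (e / 2) t
  set E : ℝ → ℝ := fun t => exp (e / 2 * t) with hE
  have hE0 : ∀ t, 0 < E t := fun t => exp_pos _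
  have hE2d : ∀ t, HasDerivAt (fun t => E t ^ 2) (e * E t ^ 2) t := by
    intro t
    refine ((hEd t).pow 2).congr_deriv ?_
    push_cast; ring
  have hElim : Tendsto E atBot (𝓝 0) := tendsto_expc (by positivity)
  have hZE : ∀ t, Zf e t = e ^ 2 * E t ^ 2 := by
    intro t
    simp only [hE, Zf]
    rw [← exp_nat_mul]
    congr 2
    push_cast; ring
  have hDlim : Tendsto (fun t => D2 * E t) atBot (𝓝 0) := by simpa using hElim.const_mul D2
  obtain ⟨t1, ht1a, ht1b⟩ := ((eventually_le_atBot ta).and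
    (hDlim.eventually (eventually_le_nhds (by norm_num : (0 : ℝ) < 1 / 2)))).exists
  have hsm : ∀ t ≤ t1, D2 * E t ≤ 1 / 2 := by
    intro t ht
    refine le_trans ?_ ht1b
    simp only [hE]
    gcongr
  have hsE : ∀ t ≤ t1, E t ≤ 1 / 16 := by
    intro t ht
    have h1 := hsm t ht
    have : 8 * E t ≤ D2 * E t := by have := hE0 t; gcongr
    linarith
  have hDE : ∀ t ≤ t1, D * E t ≤ 1 / 8 := by
    intro t ht
    have h1 := hsm t ht
    have h2 : 4 * D ≤ D2 := by rw [← hD2e]; exact mul_le_of_le_one_right hD20.le he1.le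
    have : 4 * D * E t ≤ D2 * E t := by have := hE0 t; gcongr
    linarith
  have hD2E2 : ∀ t ≤ t1, D2 * E t ^ 2 ≤ 1 / 2 * E t := by
    intro t ht
    have := mul_le_mul_of_nonneg_right (hsm t ht) (hE0 t).le
    linarith [sq (E t)]
  have hDE2 : ∀ t ≤ t1, D * E t ^ 2 ≤ 1 / 8 * E t := by
    intro t ht
    have := mul_le_mul_of_nonneg_right (hDE t ht) (hE0 t).le
    linarith [sq (E t)]
  have hE2 : ∀ t ≤ t1, E t ^ 2 ≤ 1 / 16 * E t := by
    intro t ht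
    have := mul_le_mul_of_nonneg_right (hsE t ht) (hE0 t).le
    linarith [sq (E t)]
  obtain ⟨U, P, hUP⟩ := back_exists (m := m) (n := n) (e := e) (θ := 2 + e / 2) (t1 := t1)
    (l1 := fun t => E t - D2 * E t ^ 2) (u1 := fun t => E t + E t ^ 2)
    (l2 := fun t => -(D * E t ^ 2)) (u2 := fun _ => 0)
    (l1' := fun t => e / 2 * E t - D2 * (e * E t ^ 2)) (u1' := fun t => e / 2 * E t + e * E t ^ 2)
    (l2' := fun t => -(D * (e * E t ^ 2))) (u2' := fun _ => 0)
    (fun t => (hEd t).sub ((hE2d t).const_mul D2))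
    (fun t => (hEd t).add (hE2d t))
    (fun t => ((hE2d t).const_mul D).neg)
    (fun t => hasDerivAt_const t _)
    (fun t ht => by have := hD2E2 t ht; have := hE0 t; linarith)
    (fun t ht => by
      have := hE0 t
      have : 0 < D2 * E t ^ 2 := by positivity
      have : 0 < E t ^ 2 := by positivity
      linarith)
    (fun t ht => by
      have := hE0 t
      have : 0 < D * E t ^ 2 := by positivity
      linarith)
    (by
      rintro t ht U P ⟨b1, b2, b3, b4⟩ h
      simp only at b1 b2 b3 b4 h ⊢
      have hE := hE0 t
      have hx : 0 < D * E t ^ 2 := by positivity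
      have hP : P - 2 * U = (P - (2 + e / 2) * U) + e / 2 * U := by ring
      rw [hP]
      have : e / 2 * U = e / 2 * E t - (D2 * e) * E t ^ 2 / 2 := by rw [h]; ring
      rw [this, hD2e]
      have : D2 * (e * E t ^ 2) = (D2 * e) * E t ^ 2 := by ring
      rw [this, hD2e]
      linarith)
    (by
      rintro t ht U P ⟨b1, b2, b3, b4⟩ h
      simp only at b1 b2 b3 b4 h ⊢
      have hE := hE0 t
      have hx : 0 < e * E t ^ 2 := by positivity
      have hP : P - 2 * U = (P - (2 + e / 2) * U) + e / 2 * U := by ring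
      rw [hP]
      have : e / 2 * U = e / 2 * E t + e * E t ^ 2 / 2 := by rw [h]; ring
      linarith)
    (by
      rintro t ht U P ⟨b1, b2, b3, b4⟩ h
      simp only at b1 b2 b3 b4 h ⊢
      have hE := hE0 t
      have hEsq : 0 < E t ^ 2 := by positivity
      have c1 := hD2E2 t ht
      have c2 := hDE2 t ht
      have c3 := hE2 t ht
      have hU0 : 0 < U := by linarith
      have hU2 : U ≤ 2 * E t := by linarith
      have hid := V_id (n := n) (e := e) (t := t) (P := P) hU0 hq hm
      set V := P - 2 * U with hV
      have hVe : V = -(D * E t ^ 2) + e / 2 * U := by rw [← h, hV]; ring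
      have heU : e / 2 * U ≤ 1 / 2 * U := by gcongr
      have heU0 : 0 < e / 2 * U := by positivity
      have hVabs : |V| ≤ E t := abs_le.2 ⟨by linarith, by linarith⟩
      have hVle := (abs_le.1 hVabs).2
      have k1 : q * V ^ 2 ≤ q * E t ^ 2 := by
        have : V ^ 2 ≤ E t ^ 2 := sq_le_sq' (by linarith [(abs_le.1 hVabs).1]) hVle
        gcongr
      have k2 : a * U * V ≤ 2 * a * E t ^ 2 := by
        have : a * U * V ≤ a * U * E t := by gcongr
        have : a * U * E t ≤ a * (2 * E t) * E t := by gcongr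
        linarith [sq (E t)]
      have k3 : b * U ^ 2 ≤ 4 * b * E t ^ 2 := by
        have : b * U ^ 2 ≤ b * (2 * E t) ^ 2 := by gcongr
        linarith
      have k4 : (m - 1) / m * Zf e t ≤ E t ^ 2 := by
        rw [hZE]
        have h1 : (m - 1) / m ≤ 1 := by rw [div_le_one hm0]; linarith
        have h2 : e ^ 2 ≤ 1 := pow_le_one₀ he.le he1.le
        have h3 : e ^ 2 * E t ^ 2 ≤ 1 * E t ^ 2 := by gcongr
        have h4 : (m - 1) / m * (e ^ 2 * E t ^ 2) ≤ 1 * (e ^ 2 * E t ^ 2) := by gcongr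
        linarith
      have k5 : e / 2 * U * V ≤ E t ^ 2 := by
        have h1 : e / 2 * U * V ≤ e / 2 * U * E t := by gcongr
        have h2 : e / 2 * U * E t ≤ E t * E t := by gcongr; linarith
        linarith [sq (E t)]
      have k6 : 2 / m * V - e / m * U = -(2 / m * (D * E t ^ 2)) := by rw [hVe]; ring
      have k7 : D * E t ^ 2 < 2 / m * (D * E t ^ 2) := by
        apply lt_mul_of_one_lt_left (by positivity)
        rw [lt_div_iff₀ hm0]; linarith
      have k8 : D * E t ^ 2 = q * E t ^ 2 + 2 * a * E t ^ 2 + 4 * b * E t ^ 2 + 2 * E t ^ 2 := by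
        rw [hD]; ring
      have k9 : 0 < U * (D * (e * E t ^ 2)) := by positivity
      have hfin : 0 < U * (YP m n e t U P - (2 + e / 2) * V + D * (e * E t ^ 2)) := by
        have : U * (YP m n e t U P - (2 + e / 2) * V + D * (e * E t ^ 2)) =
          U * (YP m n e t U P - 2 * V) - e / 2 * U * V + U * (D * (e * E t ^ 2)) := by ring
        rw [this, hid]
        linarith
      have := (mul_pos_iff_of_pos_left hU0).1 hfin
      linarith)
    (by
      rintro t ht U P ⟨b1, b2, b3, b4⟩ h
      simp only at b1 b2 b3 b4 h ⊢
      have hE := hE0 t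
      have c1 := hD2E2 t ht
      have hU0 : 0 < U := by linarith
      have hid := V_id (n := n) (e := e) (t := t) (P := P) hU0 hq hm
      set V := P - 2 * U with hV
      have hVe : V = e / 2 * U := by
        have : V = (P - (2 + e / 2) * U) + e / 2 * U := by rw [hV]; ring
        rw [this, h, zero_add]
      have hV0 : 0 < V := by rw [hVe]; positivity
      have hz := Zf_pos he t
      have k6 : 2 / m * V - e / m * U = 0 := by rw [hVe]; ring
      have k1 : 0 < q * V ^ 2 + a * U * V + b * U ^ 2 + (m - 1) / m * Zf e t := by positivity
      have k2 : 0 < e / 2 * U * V := by positivity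
      have hfin : 0 < U * (-(YP m n e t U P - (2 + e / 2) * V)) := by
        have : U * (-(YP m n e t U P - (2 + e / 2) * V)) =
          -(U * (YP m n e t U P - 2 * V)) + e / 2 * U * V := by ring
        rw [this, hid]
        linarith
      have := (mul_pos_iff_of_pos_left hU0).1 hfin
      linarith)
  have h5m : 5 / m = 5 * (1 / m) := by ring
  have hm1 : 1 / 2 < 1 / m := by
    apply one_div_lt_one_div_of_lt hm0 hm2
  refine ⟨t1, ht1a, U, P, fun t ht => (hUP t ht).2, ?_, ?_, ?_, ?_⟩
  · have h := (hUP t1 le_rfl).1.2.1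
    simp only at h
    have := exp_pos (2 * (ta - t1))
    have := hsE t1 le_rfl
    have := hE2 t1 le_rfl
    linarith
  · have h := (hUP t1 le_rfl).1.2.2.1
    have h' := (hUP t1 le_rfl).1.1
    simp only at h h'
    have hU0 := (hUP t1 le_rfl).2.1
    have h1 := hDE2 t1 le_rfl
    have h2 := hD2E2 t1 le_rfl
    have h3 := mul_pos hμ (Zf_pos he t1)
    have h4 := mul_pos he hU0
    have h5 := hE0 t1
    linarith
  · have h := (hUP t1 le_rfl).1.2.2.2
    have h' := (hUP t1 le_rfl).1.2.1
    simp only at h h'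
    have hU0 := (hUP t1 le_rfl).2.1
    have : e * U t1 ≤ 1 * U t1 := by gcongr
    have := hsE t1 le_rfl
    have := hE2 t1 le_rfl
    linarith
  · have g1 : Tendsto (fun t => 1 - D2 * E t) atBot (𝓝 1) := by
      simpa using hDlim.const_sub 1
    have g2 : Tendsto (fun t => 1 + E t) atBot (𝓝 1) := by
      simpa using hElim.const_add 1
    have hinv : ∀ t, E t * exp (-(e / 2) * t) = 1 := by
      intro t
      simp only [hE]
      rw [← exp_add]; simp
    refine tendsto_of_tendsto_of_tendsto_of_le_of_le' g1 g2 ?_ ?_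
    · filter_upwards [eventually_le_atBot t1] with t ht
      have h := (hUP t ht).1.1
      simp only at h
      have h2 := mul_le_mul_of_nonneg_right h (exp_pos (-(e / 2) * t)).le
      have : (E t - D2 * E t ^ 2) * exp (-(e / 2) * t) = 1 - D2 * E t := by
        linear_combination (1 - D2 * E t) * hinv t
      linarith
    · filter_upwards [eventually_le_atBot t1] with t ht
      have h := (hUP t ht).1.2.1
      simp only at h
      have h2 := mul_le_mul_of_nonneg_right h (exp_pos (-(e / 2) * t)).le
      have : (E t + E t ^ 2) * exp (-(e / 2) * t) = 1 + E t := by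
        linear_combination (1 + E t) * hinv t
      linarith

lemma prof_zero (e q f0 ts : ℝ) (U : ℝ → ℝ) : prof e q f0 ts U 0 = f0 := by simp [prof]

lemma prof_ev (e q f0 ts : ℝ) (U : ℝ → ℝ) :
    ∀ᶠ x in 𝓝[>] (0 : ℝ), 0 < x ∧ log x < ts ∧ prof e q f0 ts U x = gP e U x ^ q := by
  filter_upwards [Ioo_mem_nhdsGT (exp_pos ts)] with x hx
  refine ⟨hx.1, (log_lt_iff_lt_exp hx.1).2 hx.2, ?_⟩
  unfold prof
  rw [if_neg (not_le.2 hx.1), if_pos hx.2]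

lemma tendsto_sq_zero : Tendsto (fun x : ℝ => x ^ 2) (𝓝[>] 0) (𝓝 0) := by
  have := ((continuous_pow 2).tendsto (0 : ℝ)).mono_left (nhdsWithin_le_nhds (s := Ioi 0))
  simpa using this

lemma exp_neg_two_log {x : ℝ} (hx : 0 < x) : exp (-2 * log x) = 1 / x ^ 2 := by
  have h : exp (2 * log x) = x ^ 2 := by
    rw [two_mul, exp_add, exp_log hx, sq]
  rw [neg_mul, exp_neg, h, one_div]

lemma gq_of_zero {e q : ℝ} {U : ℝ → ℝ} {l : ℝ} (hq : 0 < q) (hl : Tendsto U atBot (𝓝 l)) :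
    Tendsto (fun x => gP e U x ^ q) (𝓝[>] 0) (𝓝 0) := by
  have h1 : Tendsto (gP e U) (𝓝[>] 0) (𝓝 (0 * l / e)) := by
    unfold gP
    exact (tendsto_sq_zero.mul (hl.comp tendsto_log_nhdsGT_zero)).div_const e
  rw [zero_mul, zero_div] at h1
  have h2 := h1.rpow_const (p := q) (Or.inr hq.le)
  rwa [zero_rpow hq.ne'] at h2

/-- Behaviour (B1). -/
lemma beh1 {m p σ e q ts A : ℝ} {N : ℕ} {U P : ℝ → ℝ} (hm : 1 < m) (hp : m + p = 2) (hN : 1 ≤ N)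
    (he : 0 < e) (hσ : σ = 2 + e) (hq : q = 1 / (m - 1)) (hA : 0 < A)
    (hsol : ∀ t < ts, IsSol m N e U P t)
    (hlim : Tendsto (fun t => U t - A * exp (-2 * t)) atBot (𝓝 ((4 + e) / (m * N) / 2))) :
    Tendsto (fun x => gP e U x ^ q) (𝓝[>] 0) (𝓝 ((A / e) ^ q)) ∧
    BehB1 N m p σ (prof e q ((A / e) ^ q) ts U) := by
  have hμ : 0 < m - 1 := by linarith
  have hm0 : 0 < m := by linarith
  have hq0 : 0 < q := by rw [hq]; positivity
  have hqμ : q * (m - 1) = 1 := by rw [hq]; field_simp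
  have hN0 : (0 : ℝ) < N := by exact_mod_cast hN
  have hAe : 0 < A / e := by positivity
  have hlim' := hlim.comp tendsto_log_nhdsGT_zero
  have hid : ∀ x : ℝ, 0 < x → gP e U x = A / e +
      x ^ 2 * (U (log x) - A * exp (-2 * log x)) / e := by
    intro x hx
    rw [exp_neg_two_log hx, gP]
    field_simp
    ring
  have hg : Tendsto (gP e U) (𝓝[>] 0) (𝓝 (A / e)) := by
    have h1 := ((tendsto_sq_zero.mul hlim').div_const e).const_add (A / e)
    rw [zero_mul, zero_div, add_zero] at h1
    refine h1.congr' ?_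
    filter_upwards [self_mem_nhdsWithin] with x hx
    rw [hid x hx]; rfl
  refine ⟨hg.rpow_const (Or.inl hAe.ne'), ?_⟩
  unfold BehB1
  rw [prof_zero]
  refine ⟨rpow_pos_of_pos hAe _, ?_⟩
  have hL : σ * (m - 1) + 2 * (p - 1) = e * (m - 1) := by
    rw [hσ, show p = 2 - m by linarith]; ring
  have hc : alphaC m p σ * (m - 1) / (2 * m * N) = (4 + e) / (m * N) / 2 / e := by
    unfold alphaC
    rw [hL, hσ]; field_simp; ring
  rw [hc]
  refine (hlim'.div_const e).congr' ?_
  filter_upwards [prof_ev e q ((A / e) ^ q) ts U] with x hx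
  obtain ⟨hx0, hxt, hxv⟩ := hx
  have hU0 := (hsol _ hxt).1
  have hg0 : 0 < gP e U x := by unfold gP; positivity
  rw [hxv, ← rpow_mul hg0.le, ← rpow_mul hAe.le, hqμ, rpow_one, rpow_one, hid x hx0]
  simp only [Function.comp]
  field_simp
  ring

/-- Behaviour (B2). -/
lemma beh2 {m e q ts : ℝ} {N : ℕ} {U P : ℝ → ℝ} (hm : 1 < m) (hN : 1 ≤ N)
    (he : 0 < e) (hq : q = 1 / (m - 1))
    (hsol : ∀ t < ts, IsSol m N e U P t)
    (hlim : Tendsto U atBot (𝓝 (e / (m * (4 * (1 / (m - 1)) + 2 * N))))) :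
    BehB2 N m (prof e q 0 ts U) := by
  have hμ : 0 < m - 1 := by linarith
  have hm0 : 0 < m := by linarith
  have hq0 : 0 < q := by rw [hq]; positivity
  have hN0 : (0 : ℝ) < N := by exact_mod_cast hN
  refine ⟨prof_zero _ _ _ _ _, ?_⟩
  have hlim' := hlim.comp tendsto_log_nhdsGT_zero
  have hc : (m - 1) / (2 * m * (m * N - N + 2)) = e / (m * (4 * (1 / (m - 1)) + 2 * N)) / e := by
    have h1 : 0 < m * N - N + 2 := by nlinarith
    have h2 : m * (4 * (1 / (m - 1)) + 2 * (N : ℝ)) = 2 * m * (m * N - N + 2) / (m - 1) := by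
      field_simp; ring
    rw [h2]
    field_simp
  rw [hc, ← hq]
  rw [← hq] at hlim'
  refine ((hlim'.div_const e).rpow_const (p := q) (Or.inr hq0.le)).congr' ?_
  filter_upwards [prof_ev e q 0 ts U] with x hx
  obtain ⟨hx0, hxt, hxv⟩ := hx
  have hU0 := (hsol _ hxt).1
  rw [hxv, gP, mul_div_assoc, mul_rpow (by positivity) (by positivity), ← rpow_natCast,
    ← rpow_mul hx0.le, mul_right_comm, ← rpow_add hx0]
  have : ((2 : ℕ) : ℝ) * q + -(2 / (m - 1)) = 0 := by rw [hq]; push_cast; ring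
  rw [this, rpow_zero, one_mul]
  rfl

/-- Behaviour (B3). -/
lemma beh3 {m p σ e q ts : ℝ} {N : ℕ} {U P : ℝ → ℝ} (hm : 1 < m) (hp : m + p = 2)
    (he : 0 < e) (hσ : σ = 2 + e) (hq : q = 1 / (m - 1))
    (hsol : ∀ t < ts, IsSol m N e U P t)
    (hlim : Tendsto (fun t => U t * exp (-(e / 2) * t)) atBot (𝓝 1)) :
    Tendsto U atBot (𝓝 0) ∧ BehB3 m p σ (prof e q 0 ts U) := by
  have hμ : 0 < m - 1 := by linarith
  have hm0 : 0 < m := by linarith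
  have hq0 : 0 < q := by rw [hq]; positivity
  constructor
  · have h1 := hlim.mul (tendsto_expc (k := e / 2) (by positivity))
    rw [mul_zero] at h1
    refine h1.congr fun t => ?_
    rw [mul_assoc, ← exp_add]; simp
  refine ⟨prof_zero _ _ _ _ _, (1 / e) ^ q, by positivity, ?_⟩
  have hlim' := hlim.comp tendsto_log_nhdsGT_zero
  refine ((hlim'.div_const e).rpow_const (p := q) (Or.inr hq0.le)).congr' ?_
  filter_upwards [prof_ev e q 0 ts U] with x hx
  obtain ⟨hx0, hxt, hxv⟩ := hx
  have hU0 := (hsol _ hxt).1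
  simp only [Function.comp]
  have hE : exp (-(e / 2) * log x) = x ^ (-(e / 2)) := by
    rw [rpow_def_of_pos hx0, mul_comm]
  rw [hxv, gP, hE]
  have h1 : x ^ 2 * U (log x) / e = U (log x) / e * x ^ (2 : ℝ) := by
    rw [rpow_two]; ring
  have h2 : U (log x) * x ^ (-(e / 2)) / e = U (log x) / e * x ^ (-(e / 2)) := by ring
  rw [h1, h2, mul_rpow (by positivity) (by positivity), mul_rpow (by positivity) (by positivity),
    ← rpow_mul hx0.le, ← rpow_mul hx0.le, mul_assoc, ← rpow_add hx0]
  congr 2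
  rw [hσ, hq, show p = 2 - m by linarith, show m - (2 - m) = 2 * (m - 1) by ring]
  field_simp
  ring

lemma Zf_log {e c : ℝ} (he : 0 < e) (hc : 0 < c) : Zf e (log (c / e ^ 2) / e) = c := by
  have : e * (log (c / e ^ 2) / e) = log (c / e ^ 2) := by field_simp
  unfold Zf
  rw [this, exp_log (by positivity)]
  field_simp

lemma limT {U U0 : ℝ → ℝ} {t1 : ℝ} {F : ℝ → ℝ → ℝ} {l : ℝ} (h : ∀ t ≤ t1, U t = U0 t)
    (hl : Tendsto (fun t => F t (U0 t)) atBot (𝓝 l)) :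
    Tendsto (fun t => F t (U t)) atBot (𝓝 l) := by
  refine hl.congr' ?_
  filter_upwards [eventually_le_atBot t1] with t ht
  rw [h t ht]

theorem all_three_behaviors_sigma_small_mp2 (m p : ℝ) (N : ℕ) (hm : 1 < m) (hp0 : 0 < p) (hp1 : p < 1) (hN : 1 ≤ N)
    (hmp : m + p = 2) :
    ∃ σ0 : ℝ, 2 < σ0 ∧
      ∀ σ : ℝ, 2 < σ → σ < σ0 →
        (∃ f : ℝ → ℝ, ∃ ξ0 : ℝ, GoodProfile N m p σ f ξ0 ∧ BehB1 N m p σ f) ∧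
        (∃ f : ℝ → ℝ, ∃ ξ0 : ℝ, GoodProfile N m p σ f ξ0 ∧ BehB2 N m f) ∧
        (∃ f : ℝ → ℝ, ∃ ξ0 : ℝ, GoodProfile N m p σ f ξ0 ∧ BehB3 m p σ f) := by
  have hm2 : m < 2 := by linarith
  have hm0 : 0 < m := by linarith
  have hμ : 0 < m - 1 := by linarith
  have hn : (1 : ℝ) ≤ N := by exact_mod_cast hN
  set M := |PhiMax m N| + 1 with hM
  have hM0 : 0 < M := by positivity
  have hMP : PhiMax m N < M := by have := le_abs_self (PhiMax m N); linarith
  set c := (m - 1) / m / (4 * m) with hc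
  have hc0 : 0 < c := by positivity
  have hl2 : 0 < log 2 := log_pos (by norm_num)
  refine ⟨2 + min 1 (log 2 * c / M), by
    have : 0 < min 1 (log 2 * c / M) := lt_min one_pos (by positivity)
    linarith, ?_⟩
  intro σ hσ2 hσ0
  obtain ⟨e, hσ⟩ : ∃ e, σ = 2 + e := ⟨σ - 2, by ring⟩
  have he : 0 < e := by linarith
  have he1 : e < 1 := by have := min_le_left 1 (log 2 * c / M); linarith
  have he2 : e < log 2 * c / M := by have := min_le_right 1 (log 2 * c / M); linarith
  set ta := log (1 / (2 * m) / e ^ 2) / e with hta'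
  set t2 := log (1 / m / e ^ 2) / e with ht2'
  have hta : Zf e ta = 1 / (2 * m) := Zf_log he (by positivity)
  have ht2 : Zf e t2 = 1 / m := Zf_log he (by positivity)
  have hdiff : t2 - ta = log 2 / e := by
    rw [hta', ht2', ← sub_div, ← log_div (by positivity) (by positivity)]
    congr 2
    field_simp
  have hlt : ta < t2 := by
    have : 0 < log 2 / e := by positivity
    linarith
  have hbig : PhiMax m N < (t2 - ta) * ((m - 1) / m / (4 * m)) := by
    rw [hdiff, ← hc]
    refine hMP.trans ?_
    rw [lt_div_iff₀ hM0] at he2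
    rw [div_mul_eq_mul_div, lt_div_iff₀ he]
    linarith
  obtain ⟨q, hq⟩ : ∃ q, q = 1 / (m - 1) := ⟨_, rfl⟩
  have hq0 : 0 < q := by rw [hq]; positivity
  refine ⟨?_, ?_, ?_⟩
  · obtain ⟨t1, h1a, U0, P0, hs, hU1, hP1, hP1', hlim⟩ :=
      back1 (n := (N : ℝ)) hm hm2 hn he he1 hta
    obtain ⟨U, P, ts, h1s, hsol, heq, hP, hU⟩ :=
      global_sol hm hm2 hn he he1 h1a hta ht2 hlt hbig hs hU1 hP1 hP1'
    have hlim2 := limT (F := fun t u => u - exp (2 * ta) * exp (-2 * t)) (fun t ht => (heq t ht).1) hlim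
    obtain ⟨g0, hB⟩ := beh1 (ts := ts) hm hmp hN he hσ hq (exp_pos _) hsol hlim2
    exact ⟨_, _, ⟨assemble hm hmp he hσ hq h1s hsol hP hU g0, Or.inl hB⟩, hB⟩
  · obtain ⟨t1, h1a, U0, P0, hs, hU1, hP1, hP1', hlim⟩ :=
      back2 (n := (N : ℝ)) (ta := ta) hm hm2 hn he he1
    obtain ⟨U, P, ts, h1s, hsol, heq, hP, hU⟩ :=
      global_sol hm hm2 hn he he1 h1a hta ht2 hlt hbig hs hU1 hP1 hP1'
    have hlim2 := limT (F := fun _ u => u) (fun t ht => (heq t ht).1) hlim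
    have hB := beh2 (ts := ts) hm hN he hq hsol hlim2
    exact ⟨_, _, ⟨assemble hm hmp he hσ hq h1s hsol hP hU (gq_of_zero hq0 hlim2),
      Or.inr (Or.inl hB)⟩, hB⟩
  · obtain ⟨t1, h1a, U0, P0, hs, hU1, hP1, hP1', hlim⟩ :=
      back3 (n := (N : ℝ)) (ta := ta) hm hm2 hn he he1
    obtain ⟨U, P, ts, h1s, hsol, heq, hP, hU⟩ :=
      global_sol hm hm2 hn he he1 h1a hta ht2 hlt hbig hs hU1 hP1 hP1'
    have hlim2 := limT (F := fun t u => u * exp (-(e / 2) * t)) (fun t ht => (heq t ht).1) hlim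
    obtain ⟨g0, hB⟩ := beh3 (ts := ts) hm hmp he hσ hq hsol hlim2
    exact ⟨_, _, ⟨assemble hm hmp he hσ hq h1s hsol hP hU (gq_of_zero hq0 g0),
      Or.inr (Or.inr hB)⟩, hB⟩
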